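/- The map T ↦ x(T) is injective on the triangulations of P; each point x(T) is an extreme point (vertex) of the polytope conv{x(T') : T' a triangulation of P}; and for every internal diagonal δ of P, the intersection of this polytope with the hyperplane {x : Σ_{j∈Bel(δ)} x_j = (bel(δ)+1)·bel(δ)/2} is a face of dimension n−1 (a facet). -/

import Mathlib

attribute [local instance] Classical.propDecidable

noncomputable section

namespace Spines

/-- Position of vertex `v ∈ {0,…,n+2}` in the counterclockwise boundary cyclic order:
`0`, then the elements of `D` in increasing order, then `n+2`, then the elements of `U`
in decreasing order. -/
def pos (n : ℕ) (D U : Finset ℕ) (v : ℕ) : ℕ :=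
  if v = 0 then 0
  else if v = n + 2 then D.card + 1
  else if v ∈ D then 1 + (D.filter (fun d => d < v)).card
  else D.card + 2 + (U.filter (fun u => v < u)).card

/-- Cyclic distance from `a` to `v` in counterclockwise direction. -/
def relpos (n : ℕ) (D U : Finset ℕ) (a v : ℕ) : ℕ :=
  (pos n D U v + (n + 3) - pos n D U a) % (n + 3)

/-- `v` lies strictly inside the counterclockwise boundary arc from `a` to `b`. -/
def StrictBetween (n : ℕ) (D U : Finset ℕ) (a b v : ℕ) : Prop :=
  v ≤ n + 2 ∧ 0 < relpos n D U a v ∧ relpos n D U a v < relpos n D U a b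

/-- A diagonal, encoded as an ordered pair `(a,b)` with `a < b ≤ n+2`. -/
def IsDiag (n : ℕ) (δ : ℕ × ℕ) : Prop := δ.1 < δ.2 ∧ δ.2 ≤ n + 2

/-- A boundary edge: the endpoints are adjacent in the cyclic order. -/
def IsBoundaryEdge (n : ℕ) (D U : Finset ℕ) (δ : ℕ × ℕ) : Prop :=
  IsDiag n δ ∧ (relpos n D U δ.1 δ.2 = 1 ∨ relpos n D U δ.2 δ.1 = 1)

/-- An internal diagonal. -/
def IsInternalDiag (n : ℕ) (D U : Finset ℕ) (δ : ℕ × ℕ) : Prop :=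
  IsDiag n δ ∧ ¬ IsBoundaryEdge n D U δ

/-- Two diagonals cross: the four endpoints are pairwise distinct and exactly one
endpoint of the second lies strictly inside each of the two arcs determined by the first. -/
def Cross (n : ℕ) (D U : Finset ℕ) (δ δ' : ℕ × ℕ) : Prop :=
  δ.1 ≠ δ.2 ∧ δ'.1 ≠ δ'.2 ∧ δ.1 ≠ δ'.1 ∧ δ.1 ≠ δ'.2 ∧ δ.2 ≠ δ'.1 ∧ δ.2 ≠ δ'.2 ∧
  ((StrictBetween n D U δ.1 δ.2 δ'.1 ∧ StrictBetween n D U δ.2 δ.1 δ'.2) ∨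
   (StrictBetween n D U δ.1 δ.2 δ'.2 ∧ StrictBetween n D U δ.2 δ.1 δ'.1))

/-- A triangulation: a maximal set of pairwise non-crossing internal diagonals. -/
def IsTriangulation (n : ℕ) (D U : Finset ℕ) (T : Finset (ℕ × ℕ)) : Prop :=
  (∀ δ ∈ T, IsInternalDiag n D U δ) ∧
  (∀ δ ∈ T, ∀ δ' ∈ T, ¬ Cross n D U δ δ') ∧
  (∀ δ, IsInternalDiag n D U δ → δ ∉ T → ∃ δ' ∈ T, Cross n D U δ δ')

/-- `a` and `b` (with `a < b`) are joined by a diagonal of `T` or a boundary edge. -/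
def EdgeOf (n : ℕ) (D U : Finset ℕ) (T : Finset (ℕ × ℕ)) (a b : ℕ) : Prop :=
  (a, b) ∈ T ∨ IsBoundaryEdge n D U (a, b)

/-- `{i,j,k}` with `i<j<k` is a triangle of the triangulation `T`. -/
def IsTriangleOf (n : ℕ) (D U : Finset ℕ) (T : Finset (ℕ × ℕ)) (i j k : ℕ) : Prop :=
  i < j ∧ j < k ∧ k ≤ n + 2 ∧
    EdgeOf n D U T i j ∧ EdgeOf n D U T j k ∧ EdgeOf n D U T i k

/-- `Bel δ`: labels in `[n+1]` strictly inside the ccw arc from `δ.1` to `δ.2`,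
together with the endpoints of `δ` lying in `U`. -/
def Bel (n : ℕ) (D U : Finset ℕ) (δ : ℕ × ℕ) : Finset ℕ :=
  (Finset.Icc 1 (n + 1)).filter
    (fun j => StrictBetween n D U δ.1 δ.2 j ∨ (j ∈ U ∧ (j = δ.1 ∨ j = δ.2)))

def bel (n : ℕ) (D U : Finset ℕ) (δ : ℕ × ℕ) : ℕ := (Bel n D U δ).card

def Abo (n : ℕ) (D U : Finset ℕ) (δ : ℕ × ℕ) : Finset ℕ :=
  Finset.Icc 1 (n + 1) \ Bel n D U δ

/-- The coordinates of the point `x(T)` associated to a triangulation `T`. -/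
def xcoord (n : ℕ) (D U : Finset ℕ) (T : Finset (ℕ × ℕ)) (j : ℕ) : ℝ :=
  if h : ∃ p : ℕ × ℕ, IsTriangleOf n D U T p.1 j p.2 then
    if j ∈ D then
      ((bel n D U (h.choose.1, j) : ℝ) + 1) * ((bel n D U (j, h.choose.2) : ℝ) + 1)
    else
      ((n : ℝ) + 2) -
        (((n : ℝ) + 2) - (bel n D U (h.choose.1, j) : ℝ)) *
          (((n : ℝ) + 2) - (bel n D U (j, h.choose.2) : ℝ))
  else 0

/-- Middle vertex of the triple `{a,b,c}` with `a < b` and `c ∉ {a,b}`. -/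
def midOf (a b c : ℕ) : ℕ := if c < a then a else if c < b then c else b

/-- `c` is the third vertex of a triangle of `T` containing the diagonal `δ`. -/
def TriWith (n : ℕ) (D U : Finset ℕ) (T : Finset (ℕ × ℕ)) (δ : ℕ × ℕ) (c : ℕ) : Prop :=
  if c < δ.1 then IsTriangleOf n D U T c δ.1 δ.2
  else if c < δ.2 then IsTriangleOf n D U T δ.1 c δ.2
  else IsTriangleOf n D U T δ.1 δ.2 c

/-- `s_δ`: middle vertex of the triangle of `T` below `δ` (third vertex strictly
inside the ccw arc from `δ.1` to `δ.2`). -/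
def spineSrc (n : ℕ) (D U : Finset ℕ) (T : Finset (ℕ × ℕ)) (δ : ℕ × ℕ) : ℕ :=
  if h : ∃ c, StrictBetween n D U δ.1 δ.2 c ∧ TriWith n D U T δ c then
    midOf δ.1 δ.2 h.choose
  else 0

/-- `t_δ`: middle vertex of the triangle of `T` above `δ` (third vertex strictly
inside the ccw arc from `δ.2` to `δ.1`). -/
def spineTgt (n : ℕ) (D U : Finset ℕ) (T : Finset (ℕ × ℕ)) (δ : ℕ × ℕ) : ℕ :=
  if h : ∃ c, StrictBetween n D U δ.2 δ.1 c ∧ TriWith n D U T δ c then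
    midOf δ.1 δ.2 h.choose
  else 0

/-- `(p,q)` is an arc of the spine of `T`. -/
def SpineArc (n : ℕ) (D U : Finset ℕ) (T : Finset (ℕ × ℕ)) (p q : ℕ) : Prop :=
  ∃ δ ∈ T, spineSrc n D U T δ = p ∧ spineTgt n D U T δ = q

/-- The finite set of all triangulations of the polygon. -/
def allTri (n : ℕ) (D U : Finset ℕ) : Finset (Finset (ℕ × ℕ)) :=
  ((Finset.range (n + 3) ×ˢ Finset.range (n + 3)).filter
      (fun δ => IsInternalDiag n D U δ)).powerset.filter
    (fun T => IsTriangulation n D U T)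

end Spines

namespace Spines

variable {n : ℕ} {D U : Finset ℕ} {T : Finset (ℕ × ℕ)}

/-- `D` and `U` partition the labels `1, …, n+1`. -/
structure Labels (n : ℕ) (D U : Finset ℕ) : Prop where
  union : D ∪ U = Finset.Icc 1 (n + 1)
  disj : Disjoint D U

namespace Labels

theorem mem_U (h : Labels n D U) {u : ℕ} (hu : u ∈ U) : 1 ≤ u ∧ u ≤ n + 1 := by
  have : u ∈ D ∪ U := Finset.mem_union_right _ hu
  rw [h.union] at this
  simpa using this

theorem mem_D_iff (h : Labels n D U) {u : ℕ} : u ∈ D ↔ 1 ≤ u ∧ u ≤ n + 1 ∧ u ∉ U := by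
  have h1 : u ∈ D ∪ U ↔ u ∈ Finset.Icc 1 (n + 1) := by rw [h.union]
  have h2 : u ∈ D → u ∉ U := fun h1 h2 => Finset.disjoint_left.1 h.disj h1 h2
  simp only [Finset.mem_union, Finset.mem_Icc] at h1
  tauto

theorem card_add (h : Labels n D U) : D.card + U.card = n + 1 := by
  rw [← Finset.card_union_of_disjoint h.disj, h.union]
  simp

theorem pos_le (h : Labels n D U) {v : ℕ} (hv : v ≤ n + 2) : pos n D U v ≤ n + 2 := by
  have h0 := h.card_add
  have h1 := Finset.card_filter_le D (fun d => d < v)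
  unfold pos
  split_ifs with ha hb hc
  · omega
  · omega
  · omega
  · have hU : v ∈ U := by
      by_contra hU
      exact hc (h.mem_D_iff.2 ⟨by omega, by omega, hU⟩)
    have : (U.filter (fun u => v < u)).card < U.card := by
      refine Finset.card_lt_card
        ((Finset.ssubset_iff_of_subset (Finset.filter_subset _ _)).2 ⟨v, hU, by simp⟩)
    omega

theorem pos_of_mem_U (h : Labels n D U) {v : ℕ} (hv : v ∈ U) :
    pos n D U v = D.card + 2 + (U.filter (fun u => v < u)).card := by
  have h1 := h.mem_U hv
  have h2 : v ∉ D := fun hD => (h.mem_D_iff.1 hD).2.2 hv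
  unfold pos
  rw [if_neg (by omega), if_neg (by omega), if_neg h2]

theorem pos_lt_of_lower (h : Labels n D U) {u v : ℕ} (hv : v ≤ n + 2) (hu : u ∉ U) (hvU : v ∉ U)
    (huv : u < v) : pos n D U u < pos n D U v := by
  have hvD : v ≠ n + 2 → v ∈ D := fun hne => h.mem_D_iff.2 ⟨by omega, by omega, hvU⟩
  have huD : u ≠ 0 → u ∈ D := fun hne => h.mem_D_iff.2 ⟨by omega, by omega, hu⟩
  have key : u ∈ D → (D.filter (fun d => d < u)).card < D.card := fun hu => by
    refine Finset.card_lt_card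
        ((Finset.ssubset_iff_of_subset (Finset.filter_subset _ _)).2 ⟨u, hu, by simp⟩)
  have key2 : u ∈ D → (D.filter (fun d => d < u)).card < (D.filter (fun d => d < v)).card :=
    fun hu => by
      refine Finset.card_lt_card
        ((Finset.ssubset_iff_of_subset ?_).2 ⟨u, by simp [hu, huv], by simp⟩)
      intro x
      simp only [Finset.mem_filter]
      exact fun hx => ⟨hx.1, hx.2.trans huv⟩
  unfold pos
  split_ifs <;> first | omega | (have := key (by tauto); have := key2 (by tauto); omega) | tauto

theorem pos_le_of_lower (h : Labels n D U) {u : ℕ} (hu : u ≤ n + 2) (huU : u ∉ U) :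
    pos n D U u ≤ D.card + 1 := by
  have h1 := Finset.card_filter_le D (fun d => d < u)
  unfold pos
  split_ifs with ha hb hc
  · omega
  · omega
  · omega
  · exact absurd (h.mem_D_iff.2 ⟨by omega, by omega, huU⟩) hc

theorem pos_lt_of_upper (h : Labels n D U) {u v : ℕ} (hu : u ∈ U) (hv : v ∈ U)
    (huv : u < v) : pos n D U v < pos n D U u := by
  rw [h.pos_of_mem_U hu, h.pos_of_mem_U hv]
  have : (U.filter (fun d => v < d)).card < (U.filter (fun d => u < d)).card := by
    refine Finset.card_lt_card
        ((Finset.ssubset_iff_of_subset ?_).2 ⟨v, by simp [hv, huv], by simp⟩)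
    intro x
    simp only [Finset.mem_filter]
    exact fun hx => ⟨hx.1, huv.trans hx.2⟩
  omega

theorem pos_lt_iff (h : Labels n D U) {u v : ℕ} (hu : u ≤ n + 2) (hv : v ≤ n + 2) :
    pos n D U u < pos n D U v ↔
      (u ∉ U ∧ v ∉ U ∧ u < v) ∨ (u ∉ U ∧ v ∈ U) ∨ (u ∈ U ∧ v ∈ U ∧ v < u) := by
  by_cases h1 : u ∈ U <;> by_cases h2 : v ∈ U <;>
    simp only [h1, h2, not_true, not_false_eq_true, true_and, false_and, or_false, false_or,
      iff_true, iff_false]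
  · rcases lt_trichotomy u v with h3 | h3 | h3
    · have := h.pos_lt_of_upper h1 h2 h3
      omega
    · subst h3; omega
    · have := h.pos_lt_of_upper h2 h1 h3
      omega
  · have := h.pos_of_mem_U h1
    have := h.pos_le_of_lower hv h2
    omega
  · have := h.pos_of_mem_U h2
    have := h.pos_le_of_lower hu h1
    omega
  · rcases lt_trichotomy u v with h3 | h3 | h3
    · have := h.pos_lt_of_lower hv h1 h2 h3
      omega
    · subst h3; omega
    · have := h.pos_lt_of_lower hu h2 h1 h3
      omega

theorem pos_inj (h : Labels n D U) {u v : ℕ} (hu : u ≤ n + 2) (hv : v ≤ n + 2)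
    (huv : pos n D U u = pos n D U v) : u = v := by
  have h1 := h.pos_lt_iff hu hv
  have h2 := h.pos_lt_iff hv hu
  rw [huv] at h1 h2
  grind

theorem exists_pos (h : Labels n D U) {p : ℕ} (hp : p ≤ n + 2) :
    ∃ v, v ≤ n + 2 ∧ pos n D U v = p := by
  have := Finset.surj_on_of_inj_on_of_card_le (s := Finset.range (n + 3))
    (t := Finset.range (n + 3))
    (fun v _ => pos n D U v)
    (fun v hv => by
      have := h.pos_le (v := v) (by simpa [Nat.lt_succ_iff] using hv)
      simp; omega)
    (fun a b ha hb hab => h.pos_inj (by simp at ha; omega) (by simp at hb; omega) hab) le_rfl p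
    (by simp; omega)
  obtain ⟨v, hv, hvp⟩ := this
  exact ⟨v, by simp at hv; omega, hvp.symm⟩

theorem relpos_eq (h : Labels n D U) {a v : ℕ} (ha : a ≤ n + 2) (hv : v ≤ n + 2) :
    relpos n D U a v = if pos n D U a ≤ pos n D U v then pos n D U v - pos n D U a
      else pos n D U v + (n + 3) - pos n D U a := by
  have h1 := h.pos_le ha
  have h2 := h.pos_le hv
  unfold relpos
  split_ifs with h3
  · rw [show pos n D U v + (n + 3) - pos n D U a = (pos n D U v - pos n D U a) + (n + 3) by omega,
      Nat.add_mod_right, Nat.mod_eq_of_lt (by omega)]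
  · rw [Nat.mod_eq_of_lt (by omega)]

end Labels

/-- The naturals `p, q, r` are in (strict) cyclic order. -/
def Cyc (p q r : ℕ) : Prop := (p < q ∧ q < r) ∨ (q < r ∧ r < p) ∨ (r < p ∧ p < q)

namespace Labels

theorem strictBetween_iff (h : Labels n D U) {a b v : ℕ} (ha : a ≤ n + 2) (hb : b ≤ n + 2)
    (hv : v ≤ n + 2) :
    StrictBetween n D U a b v ↔ Cyc (pos n D U a) (pos n D U v) (pos n D U b) := by
  have h1 := h.pos_le ha
  have h2 := h.pos_le hb
  have h3 := h.pos_le hv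
  unfold StrictBetween Cyc
  rw [h.relpos_eq ha hb, h.relpos_eq ha hv]
  split_ifs <;> omega

theorem isBoundaryEdge_iff (h : Labels n D U) {a b : ℕ} (hab : a < b) (hb : b ≤ n + 2) :
    IsBoundaryEdge n D U (a, b) ↔
      (pos n D U a + 1 = pos n D U b ∨ pos n D U b + 1 = pos n D U a ∨
        (pos n D U a = 0 ∧ pos n D U b = n + 2) ∨ (pos n D U b = 0 ∧ pos n D U a = n + 2)) := by
  have h1 := h.pos_le (show a ≤ n + 2 by omega)
  have h2 := h.pos_le hb
  unfold IsBoundaryEdge IsDiag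
  simp only
  rw [h.relpos_eq (by omega) hb, h.relpos_eq hb (by omega)]
  split_ifs <;> omega

/-- Membership in `Bel`, in terms of the order of the labels. -/
theorem mem_Bel_iff (h : Labels n D U) {a b j : ℕ} (hab : a < b) (hb : b ≤ n + 2) :
    j ∈ Bel n D U (a, b) ↔ 1 ≤ j ∧ j ≤ n + 1 ∧
      ((j ∉ U ∧ (a < j ∨ a ∈ U) ∧ (j < b ∨ b ∈ U)) ∨
        (j ∈ U ∧ ((b ∈ U ∧ b ≤ j) ∨ (a ∈ U ∧ j ≤ a)))) := by
  unfold Bel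
  simp only [Finset.mem_filter, Finset.mem_Icc, and_assoc]
  refine and_congr_right fun hj1 => and_congr_right fun hj2 => ?_
  rw [h.strictBetween_iff (by omega) hb (by omega)]
  unfold Cyc
  rw [h.pos_lt_iff (by omega) (by omega), h.pos_lt_iff (by omega) (by omega),
    h.pos_lt_iff (by omega) (by omega)]
  grind

end Labels

/-- The chords `pq` and `rs` of a circle cross. -/
def Sep (p q r s : ℕ) : Prop := (Cyc p r q ∧ Cyc q s p) ∨ (Cyc p s q ∧ Cyc q r p)

/-- `a` and `b` are joined by a diagonal of `T` or a boundary edge, in any order. -/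
def Edge (n : ℕ) (D U : Finset ℕ) (T : Finset (ℕ × ℕ)) (a b : ℕ) : Prop :=
  a ≤ n + 2 ∧ b ≤ n + 2 ∧ ((a < b ∧ EdgeOf n D U T a b) ∨ (b < a ∧ EdgeOf n D U T b a))

theorem Edge.symm {a b : ℕ} (e : Edge n D U T a b) : Edge n D U T b a :=
  ⟨e.2.1, e.1, e.2.2.symm⟩

theorem Edge.ne {a b : ℕ} (e : Edge n D U T a b) : a ≠ b := by
  rcases e.2.2 with h | h
  · exact h.1.ne
  · exact h.1.ne'

theorem Edge.edgeOf {a b : ℕ} (e : Edge n D U T a b) (hab : a < b) : EdgeOf n D U T a b := by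
  rcases e.2.2 with h | h
  · exact h.2
  · exact absurd h.1 hab.asymm

theorem EdgeOf.edge {a b : ℕ} (e : EdgeOf n D U T a b) (hab : a < b) (hb : b ≤ n + 2) :
    Edge n D U T a b := ⟨by omega, hb, Or.inl ⟨hab, e⟩⟩

theorem Cyc.rotate {p q r : ℕ} (h : Cyc p q r) : Cyc q r p := by
  unfold Cyc at *; omega

theorem Cyc.between {p q r s : ℕ} (hs : Cyc p s r) (hne : s ≠ q) :
    Cyc p s q ∨ Cyc q s r := by
  unfold Cyc at *; omega

theorem Cyc.rotate_right {p q r s : ℕ} (h : Cyc p q r) (hs : Cyc r s p) : Cyc q s p := by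
  unfold Cyc at *; omega

theorem Cyc.rotate_left {p q r s : ℕ} (h : Cyc p q r) (hs : Cyc r s p) : Cyc r s q := by
  unfold Cyc at *; omega

theorem Sep.swap_left {p q r s : ℕ} (e : Sep p q r s) : Sep q p r s := by
  unfold Sep at *; tauto

theorem Sep.swap_right {p q r s : ℕ} (e : Sep p q r s) : Sep p q s r := by
  unfold Sep at *; tauto

theorem Sep.symm {p q r s : ℕ} (e : Sep p q r s) : Sep r s p q := by
  unfold Sep Cyc at *; omega

namespace Labels

theorem cross_iff (h : Labels n D U) {a b c d : ℕ} (ha : a ≤ n + 2) (hb : b ≤ n + 2)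
    (hc : c ≤ n + 2) (hd : d ≤ n + 2) :
    Cross n D U (a, b) (c, d) ↔
      Sep (pos n D U a) (pos n D U b) (pos n D U c) (pos n D U d) := by
  unfold Cross Sep
  simp only
  rw [h.strictBetween_iff ha hb hc, h.strictBetween_iff hb ha hd, h.strictBetween_iff ha hb hd,
    h.strictBetween_iff hb ha hc]
  refine ⟨fun hh => hh.2.2.2.2.2.2, fun hh => ⟨?_, ?_, ?_, ?_, ?_, ?_, hh⟩⟩ <;> rintro rfl <;>
    unfold Cyc at hh <;> omega

/-- The pair `{a, b}` written in increasing order is a boundary edge when the positions are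
adjacent. -/
theorem edge_of_adjacent (h : Labels n D U) {a b : ℕ} (ha : a ≤ n + 2) (hb : b ≤ n + 2)
    (hab : pos n D U a + 1 = pos n D U b ∨ pos n D U b + 1 = pos n D U a ∨
        (pos n D U a = 0 ∧ pos n D U b = n + 2) ∨ (pos n D U b = 0 ∧ pos n D U a = n + 2)) :
    Edge n D U T a b := by
  rcases lt_trichotomy a b with h1 | h1 | h1
  · exact EdgeOf.edge (Or.inr ((h.isBoundaryEdge_iff h1 hb).2 hab)) h1 hb
  · subst h1; omega
  · exact (EdgeOf.edge (Or.inr ((h.isBoundaryEdge_iff h1 ha).2 (by tauto))) h1 ha).symm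

theorem not_sep_of_edgeOf (h : Labels n D U) (hT : IsTriangulation n D U T) {a b c d : ℕ}
    (hab : a < b) (hb : b ≤ n + 2) (hcd : c < d) (hd : d ≤ n + 2)
    (e : EdgeOf n D U T a b) (e' : EdgeOf n D U T c d) :
    ¬ Sep (pos n D U a) (pos n D U b) (pos n D U c) (pos n D U d) := by
  have ha : a ≤ n + 2 := by omega
  have hc : c ≤ n + 2 := by omega
  have h1 := h.pos_le ha
  have h2 := h.pos_le hb
  have h3 := h.pos_le hc
  have h4 := h.pos_le hd
  rcases e with e | e
  · rcases e' with e' | e'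
    · rw [← h.cross_iff ha hb hc hd]
      exact hT.2.1 _ e _ e'
    · rw [h.isBoundaryEdge_iff hcd hd] at e'
      unfold Sep Cyc
      omega
  · rw [h.isBoundaryEdge_iff hab hb] at e
    unfold Sep Cyc
    omega

theorem not_sep (h : Labels n D U) (hT : IsTriangulation n D U T) {a b c d : ℕ}
    (e : Edge n D U T a b) (e' : Edge n D U T c d) :
    ¬ Sep (pos n D U a) (pos n D U b) (pos n D U c) (pos n D U d) := by
  obtain ⟨ha, hb, e⟩ := e
  obtain ⟨hc, hd, e'⟩ := e'
  rcases e with ⟨h1, e⟩ | ⟨h1, e⟩ <;> rcases e' with ⟨h2, e'⟩ | ⟨h2, e'⟩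
  · exact h.not_sep_of_edgeOf hT h1 hb h2 hd e e'
  · exact fun hs => h.not_sep_of_edgeOf hT h1 hb h2 hc e e' hs.swap_right
  · exact fun hs => h.not_sep_of_edgeOf hT h1 ha h2 hd e e' hs.swap_left
  · exact fun hs => h.not_sep_of_edgeOf hT h1 ha h2 hc e e' hs.swap_left.swap_right

theorem edge_of_mem (hT : IsTriangulation n D U T) {δ : ℕ × ℕ} (hδ : δ ∈ T) :
    δ.1 < δ.2 ∧ δ.2 ≤ n + 2 ∧ Edge n D U T δ.1 δ.2 := by
  have h1 := (hT.1 δ hδ).1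
  exact ⟨h1.1, h1.2, EdgeOf.edge (Or.inl hδ) h1.1 h1.2⟩

theorem exists_mem_sep (h : Labels n D U) (hT : IsTriangulation n D U T) {a b : ℕ}
    (hab : a < b) (hb : b ≤ n + 2) (e : ¬ EdgeOf n D U T a b) :
    ∃ δ ∈ T, Sep (pos n D U a) (pos n D U b) (pos n D U δ.1) (pos n D U δ.2) := by
  unfold EdgeOf at e
  push Not at e
  obtain ⟨δ, hδ, hc⟩ := hT.2.2 (a, b) ⟨⟨hab, hb⟩, e.2⟩ e.1
  have h1 := edge_of_mem hT hδ
  exact ⟨δ, hδ, (h.cross_iff (by omega) hb (by omega) h1.2.1).1 hc⟩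

theorem exists_edge_sep (h : Labels n D U) (hT : IsTriangulation n D U T) {a b : ℕ}
    (ha : a ≤ n + 2) (hb : b ≤ n + 2) (hab : a ≠ b) (e : ¬ Edge n D U T a b) :
    ∃ c d, Edge n D U T c d ∧
      Cyc (pos n D U a) (pos n D U c) (pos n D U b) ∧
      Cyc (pos n D U b) (pos n D U d) (pos n D U a) := by
  have key : ∃ c d, Edge n D U T c d ∧
      Sep (pos n D U a) (pos n D U b) (pos n D U c) (pos n D U d) := by
    rcases lt_or_gt_of_ne hab with h1 | h1
    · obtain ⟨δ, hδ, hs⟩ := h.exists_mem_sep hT h1 hb (fun e' => e (e'.edge h1 hb))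
      exact ⟨_, _, (edge_of_mem hT hδ).2.2, hs⟩
    · obtain ⟨δ, hδ, hs⟩ := h.exists_mem_sep hT h1 ha (fun e' => e (e'.edge h1 ha).symm)
      exact ⟨_, _, (edge_of_mem hT hδ).2.2, hs.swap_left⟩
  obtain ⟨c, d, e, hs | hs⟩ := key
  · exact ⟨c, d, e, hs⟩
  · exact ⟨d, c, e.symm, hs⟩

/-- Two edges at `j` that are consecutive in the fan of `j` span a triangle. -/
theorem edge_of_fan (h : Labels n D U) (hT : IsTriangulation n D U T) {i j k : ℕ}
    (ei : Edge n D U T j i) (ek : Edge n D U T j k)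
    (hc : Cyc (pos n D U i) (pos n D U j) (pos n D U k))
    (hw : ∀ w, Edge n D U T j w → ¬ Cyc (pos n D U k) (pos n D U w) (pos n D U i)) :
    Edge n D U T i k := by
  by_contra hne
  have hik : i ≠ k := by
    rintro rfl
    unfold Cyc at hc
    omega
  obtain ⟨c, d, e, h1, h2⟩ := h.exists_edge_sep hT ei.2.1 ek.2.1 hik hne
  have h3 := h.not_sep hT ei e
  have h4 := h.not_sep hT ek e
  have h5 : pos n D U c = pos n D U j := by
    by_contra hcj
    rcases h1.between hcj with h6 | h6
    · exact h3 (Or.inr ⟨hc.rotate_right h2, h6⟩)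
    · exact h4 (Or.inl ⟨h6, hc.rotate_left h2⟩)
  have h6 := h.pos_inj e.1 ei.1 h5
  subst h6
  exact hw d e h2

/-- Length of the counterclockwise arc between two positions. -/
def arcLen (n p q : ℕ) : ℕ := if p ≤ q then q - p else q + (n + 3) - p

theorem exists_max_of_nonempty {P : ℕ → Prop} (hP : ∀ v, P v → v ≤ n + 2) (hne : ∃ v, P v)
    (f : ℕ → ℕ) : ∃ v, P v ∧ ∀ w, P w → f w ≤ f v := by
  obtain ⟨v, hv⟩ := hne
  obtain ⟨m, hm, hmax⟩ := Finset.exists_max_image ((Finset.range (n + 3)).filter P) f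
    ⟨v, by simp [hv]; have := hP v hv; omega⟩
  refine ⟨m, (Finset.mem_filter.1 hm).2, fun w hw => hmax w ?_⟩
  have := hP w hw
  simp [hw]; omega

theorem exists_apex (h : Labels n D U) (hT : IsTriangulation n D U T) {a b v : ℕ}
    (e : Edge n D U T a b) (hv : v ≤ n + 2)
    (hc : Cyc (pos n D U a) (pos n D U v) (pos n D U b)) :
    ∃ c, Edge n D U T a c ∧ Edge n D U T c b ∧
      Cyc (pos n D U a) (pos n D U c) (pos n D U b) := by
  have h1 := h.pos_le e.1
  have h2 := h.pos_le e.2.1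
  have h3 := h.pos_le hv
  have hne : ∃ s, Edge n D U T a s ∧ Cyc (pos n D U a) (pos n D U s) (pos n D U b) := by
    by_cases hlast : pos n D U a = n + 2
    · obtain ⟨s, hs, hps⟩ := h.exists_pos (p := 0) (by omega)
      exact ⟨s, h.edge_of_adjacent e.1 hs (by omega), by unfold Cyc at *; omega⟩
    · obtain ⟨s, hs, hps⟩ := h.exists_pos (p := pos n D U a + 1) (by omega)
      exact ⟨s, h.edge_of_adjacent e.1 hs (by omega), by unfold Cyc at *; omega⟩
  obtain ⟨c, ⟨hc1, hc2⟩, hmax⟩ := exists_max_of_nonempty (n := n) (fun v hv => hv.1.2.1) hne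
    (fun v => arcLen n (pos n D U a) (pos n D U v))
  refine ⟨c, hc1, ?_, hc2⟩
  refine (h.edge_of_fan hT e hc1 (by unfold Cyc at *; omega) ?_).symm
  intro w ew hcw
  have h4 := h.pos_le ew.2.1
  have h5 := h.pos_le hc1.2.1
  have := hmax w ⟨ew, by unfold Cyc at *; omega⟩
  unfold arcLen at this
  unfold Cyc at *
  split_ifs at this <;> omega

theorem cyc_of_lower (h : Labels n D U) {i j k : ℕ} (hij : i < j) (hjk : j < k) (hk : k ≤ n + 2)
    (hj : j ∉ U) : Cyc (pos n D U i) (pos n D U j) (pos n D U k) := by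
  unfold Cyc
  rw [h.pos_lt_iff (by omega) (by omega), h.pos_lt_iff (by omega) (by omega),
    h.pos_lt_iff (by omega) (by omega)]
  grind

theorem cyc_of_upper (h : Labels n D U) {i j k : ℕ} (hij : i < j) (hjk : j < k) (hk : k ≤ n + 2)
    (hj : j ∈ U) : Cyc (pos n D U k) (pos n D U j) (pos n D U i) := by
  unfold Cyc
  rw [h.pos_lt_iff (by omega) (by omega), h.pos_lt_iff (by omega) (by omega),
    h.pos_lt_iff (by omega) (by omega)]
  grind

theorem arcLen_lt_of_cyc {p q r : ℕ} (h : Cyc p q r) (hp : p ≤ n + 2) (hq : q ≤ n + 2)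
    (hr : r ≤ n + 2) :
    arcLen n p q < arcLen n p r ∧ arcLen n q r < arcLen n p r := by
  unfold arcLen
  unfold Cyc at h
  split_ifs <;> omega

theorem exists_triangle_lower (h : Labels n D U) (hT : IsTriangulation n D U T) {j : ℕ}
    (hj1 : 1 ≤ j) (hj2 : j ≤ n + 1) (hj : j ∉ U) : ∃ i k, IsTriangleOf n D U T i j k := by
  have hjn : j ≤ n + 2 := by omega
  have hpj := h.pos_le hjn
  have hl := h.pos_lt_iff (u := j) (v := n + 2) hjn le_rfl
  have hl0 := h.pos_lt_iff (u := 0) (v := j) (by omega) hjn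
  have hnU : n + 2 ∉ U := fun hh => by have := h.mem_U hh; omega
  have h0U : 0 ∉ U := fun hh => by have := h.mem_U hh; omega
  have hpn := h.pos_le (le_refl (n + 2))
  have hi : ∃ i, i < j ∧ Edge n D U T j i := by
    obtain ⟨i, hi, hpi⟩ := h.exists_pos (p := pos n D U j - 1) (by omega)
    have := h.pos_lt_iff hi hjn
    exact ⟨i, by grind, h.edge_of_adjacent hjn hi (by grind)⟩
  have hk : ∃ k, j < k ∧ Edge n D U T j k := by
    obtain ⟨k, hk, hpk⟩ := h.exists_pos (p := pos n D U j + 1) (by grind)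
    have := h.pos_lt_iff hjn hk
    have := h.pos_lt_iff (u := n + 2) le_rfl hk
    exact ⟨k, by grind, h.edge_of_adjacent hjn hk (by grind)⟩
  obtain ⟨i, ⟨hij, ei⟩, himax⟩ := exists_max_of_nonempty (n := n) (fun v hv => hv.2.2.1) hi
    (fun v => arcLen n (pos n D U v) (pos n D U j))
  obtain ⟨k, ⟨hjk, ek⟩, hkmax⟩ := exists_max_of_nonempty (n := n) (fun v hv => hv.2.2.1) hk
    (fun v => arcLen n (pos n D U j) (pos n D U v))
  have hc := h.cyc_of_lower hij hjk ek.2.1 hj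
  refine ⟨i, k, hij, hjk, ek.2.1, ei.symm.edgeOf hij, ek.edgeOf hjk,
    (h.edge_of_fan hT ei ek hc ?_).edgeOf (hij.trans hjk)⟩
  intro w ew hw
  rcases lt_or_gt_of_ne ew.ne with hjw | hjw
  · have := hkmax w ⟨hjw, ew⟩
    have := (arcLen_lt_of_cyc (n := n) (show Cyc (pos n D U j) (pos n D U k) (pos n D U w) by
      unfold Cyc at *; omega) hpj (h.pos_le ek.2.1) (h.pos_le ew.2.1)).1
    omega
  · have := himax w ⟨hjw, ew⟩
    have := (arcLen_lt_of_cyc (n := n) (show Cyc (pos n D U w) (pos n D U i) (pos n D U j) by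
      unfold Cyc at *; omega) (h.pos_le ew.2.1) (h.pos_le ei.2.1) hpj).2
    omega

theorem exists_triangle_upper (h : Labels n D U) (hT : IsTriangulation n D U T) {j : ℕ}
    (hj1 : 1 ≤ j) (hj2 : j ≤ n + 1) (hj : j ∈ U) : ∃ i k, IsTriangleOf n D U T i j k := by
  have hjn : j ≤ n + 2 := by omega
  have hpj := h.pos_le hjn
  have hl := h.pos_lt_iff (u := n + 2) (v := j) le_rfl hjn
  have hnU : n + 2 ∉ U := fun hh => by have := h.mem_U hh; omega
  have h0U : 0 ∉ U := fun hh => by have := h.mem_U hh; omega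
  have hp0 : pos n D U 0 = 0 := by simp [pos]
  have hi : ∃ i, i < j ∧ Edge n D U T j i := by
    by_cases hlast : pos n D U j = n + 2
    · exact ⟨0, by omega, h.edge_of_adjacent hjn (by omega) (by omega)⟩
    · obtain ⟨i, hi, hpi⟩ := h.exists_pos (p := pos n D U j + 1) (by omega)
      have := h.pos_lt_iff hjn hi
      exact ⟨i, by grind, h.edge_of_adjacent hjn hi (by grind)⟩
  have hk : ∃ k, j < k ∧ Edge n D U T j k := by
    obtain ⟨k, hk, hpk⟩ := h.exists_pos (p := pos n D U j - 1) (by omega)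
    have := h.pos_lt_iff hk hjn
    have := h.pos_lt_iff (v := n + 2) hk le_rfl
    exact ⟨k, by grind, h.edge_of_adjacent hjn hk (by grind)⟩
  obtain ⟨i, ⟨hij, ei⟩, himax⟩ := exists_max_of_nonempty (n := n) (fun v hv => hv.2.2.1) hi
    (fun v => arcLen n (pos n D U j) (pos n D U v))
  obtain ⟨k, ⟨hjk, ek⟩, hkmax⟩ := exists_max_of_nonempty (n := n) (fun v hv => hv.2.2.1) hk
    (fun v => arcLen n (pos n D U v) (pos n D U j))
  have hc := h.cyc_of_upper hij hjk ek.2.1 hj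
  refine ⟨i, k, hij, hjk, ek.2.1, ei.symm.edgeOf hij, ek.edgeOf hjk,
    (h.edge_of_fan hT ek ei hc ?_).symm.edgeOf (hij.trans hjk)⟩
  intro w ew hw
  rcases lt_or_gt_of_ne ew.ne with hjw | hjw
  · have := hkmax w ⟨hjw, ew⟩
    have := (arcLen_lt_of_cyc (n := n) (show Cyc (pos n D U w) (pos n D U k) (pos n D U j) by
      unfold Cyc at *; omega) (h.pos_le ew.2.1) (h.pos_le ek.2.1) hpj).2
    omega
  · have := himax w ⟨hjw, ew⟩
    have := (arcLen_lt_of_cyc (n := n) (show Cyc (pos n D U j) (pos n D U i) (pos n D U w) by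
      unfold Cyc at *; omega) hpj (h.pos_le ei.2.1) (h.pos_le ew.2.1)).1
    omega

theorem exists_triangle (h : Labels n D U) (hT : IsTriangulation n D U T) {j : ℕ}
    (hj1 : 1 ≤ j) (hj2 : j ≤ n + 1) : ∃ i k, IsTriangleOf n D U T i j k := by
  by_cases hj : j ∈ U
  · exact h.exists_triangle_upper hT hj1 hj2 hj
  · exact h.exists_triangle_lower hT hj1 hj2 hj

/-- Two triangles with a common vertex `q` that lie on the same side of `q` agree. -/
theorem eq_of_not_sep {p p' q r r' : ℕ} (h3 : Cyc p q r')
    (h4 : Cyc p' q r) (s1 : ¬ Sep p q p' r') (s2 : ¬ Sep p' q p r) (s3 : ¬ Sep q r p' r')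
    (s4 : ¬ Sep q r' p r) : p = p' ∧ r = r' := by
  constructor
  · by_contra hne
    have : Cyc p p' q ∨ Cyc p' p q := by unfold Cyc at *; omega
    rcases this with h5 | h5
    · exact s1 (Or.inl ⟨h5, by unfold Cyc at *; omega⟩)
    · exact s2 (Or.inl ⟨h5, by unfold Cyc at *; omega⟩)
  · by_contra hne
    have : Cyc q r r' ∨ Cyc q r' r := by unfold Cyc at *; omega
    rcases this with h5 | h5
    · exact s4 (Or.inr ⟨h5, by unfold Cyc at *; omega⟩)
    · exact s3 (Or.inr ⟨h5, by unfold Cyc at *; omega⟩)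

theorem triangle_unique (h : Labels n D U) (hT : IsTriangulation n D U T) {i j k i' k' : ℕ}
    (t : IsTriangleOf n D U T i j k) (t' : IsTriangleOf n D U T i' j k') : i = i' ∧ k = k' := by
  obtain ⟨hij, hjk, hk, eij, ejk, eik⟩ := t
  obtain ⟨hij', hjk', hk', eij', ejk', eik'⟩ := t'
  have e1 := eij.edge hij (by omega)
  have e2 := ejk.edge hjk hk
  have e3 := eik.edge (hij.trans hjk) hk
  have e1' := eij'.edge hij' (by omega)
  have e2' := ejk'.edge hjk' hk'
  have e3' := eik'.edge (hij'.trans hjk') hk'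
  by_cases hj : j ∈ U
  · have := eq_of_not_sep (h.cyc_of_upper hij' hjk hk hj) (h.cyc_of_upper hij hjk' hk' hj)
      (h.not_sep hT e2.symm e3'.symm) (h.not_sep hT e2'.symm e3.symm)
      (h.not_sep hT e1.symm e3'.symm) (h.not_sep hT e1'.symm e3.symm)
    exact ⟨h.pos_inj (by omega) (by omega) this.2, h.pos_inj hk hk' this.1⟩
  · have := eq_of_not_sep (h.cyc_of_lower hij hjk' hk' hj) (h.cyc_of_lower hij' hjk hk hj)
      (h.not_sep hT e1 e3') (h.not_sep hT e1' e3) (h.not_sep hT e2 e3') (h.not_sep hT e2' e3)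
    exact ⟨h.pos_inj (by omega) (by omega) this.1, h.pos_inj hk hk' this.2⟩

theorem xcoord_eq (h : Labels n D U) (hT : IsTriangulation n D U T) {i j k : ℕ}
    (t : IsTriangleOf n D U T i j k) :
    xcoord n D U T j = if j ∈ U then
      ((n : ℝ) + 2) - (((n : ℝ) + 2) - (bel n D U (i, j) : ℝ)) *
          (((n : ℝ) + 2) - (bel n D U (j, k) : ℝ))
      else ((bel n D U (i, j) : ℝ) + 1) * ((bel n D U (j, k) : ℝ) + 1) := by
  have hex : ∃ p : ℕ × ℕ, IsTriangleOf n D U T p.1 j p.2 := ⟨(i, k), t⟩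
  have hu := h.triangle_unique hT hex.choose_spec t
  have hD : j ∈ D ↔ j ∉ U := by
    rw [h.mem_D_iff]
    have h1 := t.1
    have h2 := t.2.1
    have h3 := t.2.2.1
    constructor
    · tauto
    · exact fun hh => ⟨by omega, by omega, hh⟩
  unfold xcoord
  rw [dif_pos hex, hu.1, hu.2]
  by_cases hj : j ∈ U <;> simp [hj, hD]

theorem xcoord_eq_zero {j : ℕ} (hj : j ∉ Finset.Icc 1 (n + 1)) : xcoord n D U T j = 0 := by
  unfold xcoord
  rw [dif_neg]
  rintro ⟨p, h1, h2, h3, -⟩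
  exact hj (Finset.mem_Icc.2 ⟨by omega, by omega⟩)

end Labels

/-- The triangular number `1 + 2 + ⋯ + m`, as a real number. -/
def tri (m : ℕ) : ℝ := ((m : ℝ) + 1) * (m : ℝ) / 2

/-- The slack of `x(T)` in the inequality of the diagonal `(a, b)`. -/
def excess (n : ℕ) (D U : Finset ℕ) (T : Finset (ℕ × ℕ)) (a b : ℕ) : ℝ :=
  ∑ j ∈ Bel n D U (a, b), xcoord n D U T j - tri (bel n D U (a, b))

/-- The slack of `x(T)` in the equation for the sum of all coordinates. -/
def totalExcess (n : ℕ) (D U : Finset ℕ) (T : Finset (ℕ × ℕ)) : ℝ :=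
  ∑ j ∈ Finset.Icc 1 (n + 1), xcoord n D U T j - tri (n + 1)

/-- The slack of `x(T)` for the ordered pair `(a, b)`, complemented when `b < a`. -/
def dirExcess (n : ℕ) (D U : Finset ℕ) (T : Finset (ℕ × ℕ)) (a b : ℕ) : ℝ :=
  if a < b then excess n D U T a b else totalExcess n D U T - excess n D U T b a

namespace Labels

theorem sum_Bel_lower (h : Labels n D U) {i j k : ℕ} (hij : i < j) (hjk : j < k) (hk : k ≤ n + 2)
    (hj : j ∉ U) (y : ℕ → ℝ) : ∑ l ∈ Bel n D U (i, k), y l =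
      ∑ l ∈ Bel n D U (i, j), y l + ∑ l ∈ Bel n D U (j, k), y l + y j := by
  have hiu := fun l : ℕ => h.mem_Bel_iff (j := l) (show i < j from hij) (by omega)
  have hju := fun l : ℕ => h.mem_Bel_iff (j := l) (show j < k from hjk) (by omega)
  have hku := fun l : ℕ => h.mem_Bel_iff (j := l) (show i < k by omega) (by omega)
  have h1 : Bel n D U (i, k) = insert j (Bel n D U (i, j) ∪ Bel n D U (j, k)) := by
    ext l
    simp only [Finset.mem_insert, Finset.mem_union, hiu, hju, hku]
    grind
  have h2 : j ∉ Bel n D U (i, j) ∪ Bel n D U (j, k) := by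
    simp only [Finset.mem_union, hiu, hju]
    grind
  have h3 : Disjoint (Bel n D U (i, j)) (Bel n D U (j, k)) := by
    rw [Finset.disjoint_left]
    intro l
    rw [hiu, hju]
    grind
  rw [h1, Finset.sum_insert h2, Finset.sum_union h3]
  ring

theorem sum_Bel_upper (h : Labels n D U) {i j k : ℕ} (hij : i < j) (hjk : j < k) (hk : k ≤ n + 2)
    (hj : j ∈ U) (y : ℕ → ℝ) :
    ∑ l ∈ Bel n D U (i, j), y l + ∑ l ∈ Bel n D U (j, k), y l =
      ∑ l ∈ Bel n D U (i, k), y l + ∑ l ∈ Finset.Icc 1 (n + 1), y l + y j := by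
  have hiu := fun l : ℕ => h.mem_Bel_iff (j := l) (show i < j from hij) (by omega)
  have hju := fun l : ℕ => h.mem_Bel_iff (j := l) (show j < k from hjk) (by omega)
  have hku := fun l : ℕ => h.mem_Bel_iff (j := l) (show i < k by omega) (by omega)
  have h1 : Bel n D U (i, j) ∪ Bel n D U (j, k) = Finset.Icc 1 (n + 1) := by
    ext l
    simp only [Finset.mem_Icc, Finset.mem_union, hiu, hju]
    grind
  have h2 : Bel n D U (i, j) ∩ Bel n D U (j, k) = insert j (Bel n D U (i, k)) := by
    ext l
    simp only [Finset.mem_insert, Finset.mem_inter, hiu, hju, hku]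
    grind
  have h3 : j ∉ Bel n D U (i, k) := by
    rw [hku]
    grind
  rw [← Finset.sum_union_inter, h1, h2, Finset.sum_insert h3]
  ring

theorem sum_one (A : Finset ℕ) : ∑ _l ∈ A, (1 : ℝ) = A.card := by simp

theorem excess_lower (h : Labels n D U) (hT : IsTriangulation n D U T) {i j k : ℕ}
    (t : IsTriangleOf n D U T i j k) (hj : j ∉ U) :
    excess n D U T i k = excess n D U T i j + excess n D U T j k := by
  have h1 := h.sum_Bel_lower t.1 t.2.1 t.2.2.1 hj (xcoord n D U T)
  have h2 := h.sum_Bel_lower t.1 t.2.1 t.2.2.1 hj (fun _ => 1)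
  have h3 := h.xcoord_eq hT t
  rw [if_neg hj] at h3
  simp only [sum_one] at h2
  unfold excess tri
  rw [h1, h3]
  unfold bel
  rw [h2]
  ring

theorem excess_upper (h : Labels n D U) (hT : IsTriangulation n D U T) {i j k : ℕ}
    (t : IsTriangleOf n D U T i j k) (hj : j ∈ U) :
    excess n D U T i j + excess n D U T j k = excess n D U T i k + totalExcess n D U T := by
  have h1 := h.sum_Bel_upper t.1 t.2.1 t.2.2.1 hj (xcoord n D U T)
  have h2 := h.sum_Bel_upper t.1 t.2.1 t.2.2.1 hj (fun _ => 1)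
  have h3 := h.xcoord_eq hT t
  rw [if_pos hj] at h3
  simp only [sum_one, Nat.card_Icc, Nat.add_sub_cancel] at h2
  have h4 : ((Bel n D U (i, k)).card : ℝ) =
      (Bel n D U (i, j)).card + (Bel n D U (j, k)).card - (n + 2) := by
    push_cast at h2
    linarith
  unfold excess totalExcess tri
  rw [h3] at h1
  unfold bel at *
  rw [h4]
  push_cast
  linarith

theorem dirExcess_swap {a b : ℕ} (hab : a ≠ b) :
    dirExcess n D U T a b = totalExcess n D U T - dirExcess n D U T b a := by
  unfold dirExcess
  rcases lt_or_gt_of_ne hab with h1 | h1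
  · rw [if_pos h1, if_neg h1.asymm]; ring
  · rw [if_neg h1.asymm, if_pos h1]

theorem triangle_of_edges {i j k : ℕ} (hij : i < j) (hjk : j < k)
    (e1 : Edge n D U T i j) (e2 : Edge n D U T j k) (e3 : Edge n D U T i k) :
    IsTriangleOf n D U T i j k :=
  ⟨hij, hjk, e2.2.1, e1.edgeOf hij, e2.edgeOf hjk, e3.edgeOf (hij.trans hjk)⟩

/-- The orientation of a triangle determines whether its middle vertex is an up label. -/
theorem not_mem_U_of_cyc (h : Labels n D U) {i j k : ℕ} (hij : i < j) (hjk : j < k)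
    (hk : k ≤ n + 2) (hc : Cyc (pos n D U i) (pos n D U j) (pos n D U k)) : j ∉ U := by
  intro hj
  have := h.cyc_of_upper hij hjk hk hj
  unfold Cyc at *
  omega

theorem mem_U_of_cyc (h : Labels n D U) {i j k : ℕ} (hij : i < j) (hjk : j < k)
    (hk : k ≤ n + 2) (hc : Cyc (pos n D U k) (pos n D U j) (pos n D U i)) : j ∈ U := by
  by_contra hj
  have := h.cyc_of_lower hij hjk hk hj
  unfold Cyc at *
  omega

theorem dirExcess_add (h : Labels n D U) (hT : IsTriangulation n D U T) {a c b : ℕ}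
    (e1 : Edge n D U T a c) (e2 : Edge n D U T c b) (e3 : Edge n D U T a b)
    (hc : Cyc (pos n D U a) (pos n D U c) (pos n D U b)) :
    dirExcess n D U T a b = dirExcess n D U T a c + dirExcess n D U T c b := by
  have lower : ∀ {i j k : ℕ}, i < j → j < k → Edge n D U T i j → Edge n D U T j k →
      Edge n D U T i k → Cyc (pos n D U i) (pos n D U j) (pos n D U k) →
      excess n D U T i k = excess n D U T i j + excess n D U T j k :=
    fun hij hjk e1 e2 e3 hc => h.excess_lower hT (triangle_of_edges hij hjk e1 e2 e3)
      (h.not_mem_U_of_cyc hij hjk e2.2.1 hc)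
  have upper : ∀ {i j k : ℕ}, i < j → j < k → Edge n D U T i j → Edge n D U T j k →
      Edge n D U T i k → Cyc (pos n D U k) (pos n D U j) (pos n D U i) →
      excess n D U T i j + excess n D U T j k = excess n D U T i k + totalExcess n D U T :=
    fun hij hjk e1 e2 e3 hc => h.excess_upper hT (triangle_of_edges hij hjk e1 e2 e3)
      (h.mem_U_of_cyc hij hjk e2.2.1 hc)
  have hc2 := hc.rotate
  have hc3 := hc2.rotate
  unfold dirExcess
  rcases lt_or_gt_of_ne e1.ne with h1 | h1 <;> rcases lt_or_gt_of_ne e2.ne with h2 | h2 <;>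
    rcases lt_or_gt_of_ne e3.ne with h3 | h3
  · have := lower h1 h2 e1 e2 e3 hc
    simp only [h1, h2, h3, if_true]; linarith
  · omega
  · have := upper h3 h2 e3 e2.symm e1 hc2
    simp only [h1, h2.asymm, h3, if_true, if_false]; linarith
  · have := lower h3 h1 e3.symm e1 e2.symm hc3
    simp only [h1, h2.asymm, h3.asymm, if_true, if_false]; linarith
  · have := upper h1 h3 e1.symm e3 e2 hc3
    simp only [h1.asymm, h2, h3, if_true, if_false]; linarith
  · have := lower h2 h3 e2 e3.symm e1.symm hc2
    simp only [h1.asymm, h2, h3.asymm, if_true, if_false]; linarith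
  · omega
  · have := upper h2 h1 e2.symm e1.symm e3.symm hc
    simp only [h1.asymm, h2.asymm, h3.asymm, if_false]; linarith

/-- `Bel` is empty for edges of the lower boundary. -/
theorem Bel_eq_empty (h : Labels n D U) {a b : ℕ} (hab : a < b) (hb : b ≤ n + 2)
    (hv : ∀ v, v ≤ n + 2 → ¬ Cyc (pos n D U a) (pos n D U v) (pos n D U b)) :
    Bel n D U (a, b) = ∅ := by
  have hnU : n + 2 ∉ U := fun hh => by have := h.mem_U hh; omega
  have h0U : 0 ∉ U := fun hh => by have := h.mem_U hh; omega
  have key : ∀ v, v ≤ n + 2 → _ := fun v hvn => by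
    have := hv v hvn
    unfold Cyc at this
    rw [h.pos_lt_iff (by omega) hvn, h.pos_lt_iff hvn hb, h.pos_lt_iff hb (by omega)] at this
    exact this
  have k0 := key 0 (by omega)
  have kn := key (n + 2) le_rfl
  ext l
  rw [h.mem_Bel_iff hab hb]
  simp only [Finset.notMem_empty, iff_false]
  rintro ⟨hl1, hl2, hl⟩
  have kl := key l (by omega)
  clear key hv
  grind

/-- `Bel` is full for edges of the upper boundary. -/
theorem Bel_eq_Icc (h : Labels n D U) {a b : ℕ} (hab : a < b) (hb : b ≤ n + 2)
    (hv : ∀ v, v ≤ n + 2 → ¬ Cyc (pos n D U b) (pos n D U v) (pos n D U a)) :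
    Bel n D U (a, b) = Finset.Icc 1 (n + 1) := by
  have hnU : n + 2 ∉ U := fun hh => by have := h.mem_U hh; omega
  have h0U : 0 ∉ U := fun hh => by have := h.mem_U hh; omega
  have key : ∀ v, v ≤ n + 2 → _ := fun v hvn => by
    have := hv v hvn
    unfold Cyc at this
    rw [h.pos_lt_iff hb hvn, h.pos_lt_iff hvn (by omega), h.pos_lt_iff (by omega) hb] at this
    exact this
  have k0 := key 0 (by omega)
  have kn := key (n + 2) le_rfl
  ext l
  rw [h.mem_Bel_iff hab hb, Finset.mem_Icc]
  refine ⟨fun hh => ⟨hh.1, hh.2.1⟩, fun hh => ⟨hh.1, hh.2, ?_⟩⟩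
  have kl := key l (by omega)
  clear key hv
  grind

theorem dirExcess_eq_zero_of_empty (h : Labels n D U) {a b : ℕ} (ha : a ≤ n + 2) (hb : b ≤ n + 2)
    (hab : a ≠ b)
    (hv : ∀ v, v ≤ n + 2 → ¬ Cyc (pos n D U a) (pos n D U v) (pos n D U b)) :
    dirExcess n D U T a b = 0 := by
  unfold dirExcess
  rcases lt_or_gt_of_ne hab with h1 | h1
  · rw [if_pos h1]
    simp [excess, bel, h.Bel_eq_empty h1 hb hv, tri]
  · rw [if_neg h1.asymm]
    simp [excess, totalExcess, bel, h.Bel_eq_Icc h1 ha hv]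

theorem dirExcess_eq_zero (h : Labels n D U) (hT : IsTriangulation n D U T) {a b : ℕ}
    (e : Edge n D U T a b) : dirExcess n D U T a b = 0 := by
  by_cases hex : ∃ v, v ≤ n + 2 ∧ Cyc (pos n D U a) (pos n D U v) (pos n D U b)
  · obtain ⟨v, hv, hc⟩ := hex
    obtain ⟨c, e1, e2, hc'⟩ := h.exists_apex hT e hv hc
    have hlt := arcLen_lt_of_cyc hc' (h.pos_le e.1) (h.pos_le e1.2.1) (h.pos_le e.2.1)
    rw [h.dirExcess_add hT e1 e2 e hc', h.dirExcess_eq_zero hT e1, h.dirExcess_eq_zero hT e2,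
      add_zero]
  · push Not at hex
    exact h.dirExcess_eq_zero_of_empty e.1 e.2.1 e.ne hex
termination_by arcLen n (pos n D U a) (pos n D U b)
decreasing_by
  · exact hlt.1
  · exact hlt.2

theorem totalExcess_eq_zero (h : Labels n D U) (hT : IsTriangulation n D U T) :
    totalExcess n D U T = 0 := by
  obtain ⟨i, k, t⟩ := h.exists_triangle hT (j := 1) le_rfl (by omega)
  have e := t.2.2.2.1.edge t.1 (by have := t.2.1; have := t.2.2.1; omega)
  have := dirExcess_swap (n := n) (D := D) (U := U) (T := T) e.ne
  rw [h.dirExcess_eq_zero hT e, h.dirExcess_eq_zero hT e.symm] at this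
  linarith

theorem excess_eq_zero (h : Labels n D U) (hT : IsTriangulation n D U T) {a b : ℕ}
    (hab : a < b) (e : Edge n D U T a b) : excess n D U T a b = 0 := by
  have := h.dirExcess_eq_zero hT e
  rwa [dirExcess, if_pos hab] at this

end Labels

/-- A chord `ef` that crosses `ad` but not `cd` crosses every chord `ab` that crosses `cd`. -/
theorem Sep.of_sep {a b c d e f : ℕ} (h : Sep a b c d) (h1 : Sep a d e f) (h2 : ¬ Sep c d e f) :
    Sep a b e f := by
  have left : ∀ e f, Cyc a c b → Cyc b d a → Cyc a e d → Cyc d f a → ¬ Sep c d e f →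
      Sep a b e f := by
    intro e f hc hd he hf hn
    have h3 : ¬ Cyc c e d := fun hh => hn (Or.inl ⟨hh, by unfold Cyc at *; omega⟩)
    exact Or.inl ⟨by unfold Cyc at *; omega, by unfold Cyc at *; omega⟩
  have right : ∀ e f, Cyc b c a → Cyc a d b → Cyc d e a → Cyc a f d → ¬ Sep c d e f →
      Sep a b e f := by
    intro e f hc hd he hf hn
    have h3 : ¬ Cyc d e c := fun hh => hn (Or.inr ⟨by unfold Cyc at *; omega, hh⟩)
    exact Or.inr ⟨by unfold Cyc at *; omega, by unfold Cyc at *; omega⟩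
  rcases h with ⟨hc, hd⟩ | ⟨hd, hc⟩ <;> rcases h1 with ⟨he, hf⟩ | ⟨hf, he⟩
  · exact left e f hc hd he hf h2
  · exact (left f e hc hd hf he (fun hh => h2 hh.swap_right)).swap_right
  · exact (right f e hc hd hf he (fun hh => h2 hh.swap_right)).swap_right
  · exact right e f hc hd he hf h2

namespace Labels

theorem lt_of_cyc_cyc (h : Labels n D U) {a b c d : ℕ} (hab : a < b) (hb : b ≤ n + 2)
    (hcd : c < d) (hd : d ≤ n + 2) (h1 : Cyc (pos n D U a) (pos n D U c) (pos n D U b))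
    (h2 : Cyc (pos n D U b) (pos n D U d) (pos n D U a)) : a < d ∧ c < b := by
  have h3 : d ≠ a := by rintro rfl; unfold Cyc at h2; omega
  have h4 : c ≠ b := by rintro rfl; unfold Cyc at h1; omega
  constructor
  · by_contra hh
    have h6 := h.not_mem_U_of_cyc (i := c) (j := d) (k := a) hcd (by omega) (by omega)
      (by unfold Cyc at *; omega)
    have h8 := h.cyc_of_lower (i := c) (j := d) (k := b) hcd (by omega) hb h6
    unfold Cyc at *
    omega
  · by_contra hh
    have h5 := h.mem_U_of_cyc (i := a) (j := b) (k := c) hab (by omega) (by omega)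
      (by unfold Cyc at *; omega)
    have h8 := h.cyc_of_upper (i := a) (j := b) (k := d) hab (by omega) hd h5
    unfold Cyc at *
    omega

theorem Bel_union_inter (h : Labels n D U) {a b c d : ℕ} (hab : a < b) (hb : b ≤ n + 2)
    (hcd : c < d) (hd : d ≤ n + 2) (h1 : Cyc (pos n D U a) (pos n D U c) (pos n D U b))
    (h2 : Cyc (pos n D U b) (pos n D U d) (pos n D U a)) :
    Bel n D U (a, b) ∪ Bel n D U (c, d) = Bel n D U (a, d) ∧
    Bel n D U (a, b) ∩ Bel n D U (c, d) = Bel n D U (c, b) ∧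
    (∃ l ∈ Bel n D U (a, b), l ∉ Bel n D U (c, b)) ∧
    (∃ l ∈ Bel n D U (c, d), l ∉ Bel n D U (c, b)) := by
  obtain ⟨had, hcb⟩ := h.lt_of_cyc_cyc hab hb hcd hd h1 h2
  have hnU : n + 2 ∉ U := fun hh => by have := h.mem_U hh; omega
  have h0U : 0 ∉ U := fun hh => by have := h.mem_U hh; omega
  have k1 := fun l : ℕ => h.mem_Bel_iff (j := l) hab hb
  have k2 := fun l : ℕ => h.mem_Bel_iff (j := l) hcd hd
  have k3 := fun l : ℕ => h.mem_Bel_iff (j := l) had hd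
  have k4 := fun l : ℕ => h.mem_Bel_iff (j := l) hcb hb
  unfold Cyc at h1 h2
  rw [h.pos_lt_iff (by omega) (by omega), h.pos_lt_iff (by omega) (by omega),
    h.pos_lt_iff (by omega) (by omega)] at h1 h2
  refine ⟨?_, ?_, ?_, ?_⟩
  · ext l
    simp only [Finset.mem_union, k1, k2, k3]
    clear k1 k2 k3 k4
    by_cases ha : a ∈ U <;> by_cases hbU : b ∈ U <;> by_cases hc : c ∈ U <;>
      by_cases hdU : d ∈ U <;> by_cases hl : l ∈ U <;>
      simp only [ha, hbU, hc, hdU, hl, not_true, not_false_eq_true, true_and, false_and, or_false,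
        false_or, and_false, and_true, or_true] at h1 h2 ⊢ <;> grind
  · ext l
    simp only [Finset.mem_inter, k1, k2, k4]
    clear k1 k2 k3 k4
    by_cases ha : a ∈ U <;> by_cases hbU : b ∈ U <;> by_cases hc : c ∈ U <;>
      by_cases hdU : d ∈ U <;> by_cases hl : l ∈ U <;>
      simp only [ha, hbU, hc, hdU, hl, not_true, not_false_eq_true, true_and, false_and, or_false,
        false_or, and_false, and_true, or_true] at h1 h2 ⊢ <;> grind
  · by_cases hc : c ∈ U ∨ c = 0
    · exact ⟨a, by rw [k1]; grind, by rw [k4]; grind⟩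
    · exact ⟨c, by rw [k1]; grind, by rw [k4]; grind⟩
  · by_cases hc : b ∈ U ∨ b = n + 2
    · exact ⟨d, by rw [k2]; grind, by rw [k4]; grind⟩
    · exact ⟨b, by rw [k2]; grind, by rw [k4]; grind⟩

theorem tri_add_lt {p q u i : ℕ} (h : u + i = p + q) (hp : i < p) (hq : i < q) :
    tri p + tri q < tri u + tri i := by
  have h1 : (u : ℝ) = p + q - i := by
    rw [eq_sub_iff_add_eq]; exact_mod_cast h
  have h2 : (i : ℝ) < p := by exact_mod_cast hp
  have h3 : (i : ℝ) < q := by exact_mod_cast hq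
  unfold tri
  rw [h1]
  nlinarith [mul_pos (sub_pos.2 h2) (sub_pos.2 h3)]

theorem excess_cross (h : Labels n D U) {a b c d : ℕ} (hab : a < b) (hb : b ≤ n + 2)
    (hcd : c < d) (hd : d ≤ n + 2) (h1 : Cyc (pos n D U a) (pos n D U c) (pos n D U b))
    (h2 : Cyc (pos n D U b) (pos n D U d) (pos n D U a)) :
    excess n D U T a d + excess n D U T c b < excess n D U T a b + excess n D U T c d := by
  obtain ⟨hu, hi, ⟨l, hl, hl'⟩, ⟨m, hm, hm'⟩⟩ := h.Bel_union_inter hab hb hcd hd h1 h2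
  have hsum := Finset.sum_union_inter (s₁ := Bel n D U (a, b)) (s₂ := Bel n D U (c, d))
    (f := xcoord n D U T)
  have hcard := Finset.card_union_add_card_inter (Bel n D U (a, b)) (Bel n D U (c, d))
  rw [hu, hi] at hsum hcard
  have hsub1 : Bel n D U (c, b) ⊆ Bel n D U (a, b) := hi ▸ Finset.inter_subset_left
  have hsub2 : Bel n D U (c, b) ⊆ Bel n D U (c, d) := hi ▸ Finset.inter_subset_right
  have hlt := tri_add_lt hcard
    (Finset.card_lt_card
        ((Finset.ssubset_iff_of_subset hsub1).2 ⟨l, hl, hl'⟩))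
    (Finset.card_lt_card
        ((Finset.ssubset_iff_of_subset hsub2).2 ⟨m, hm, hm'⟩))
  unfold excess bel
  linarith

/-- Diagonals of `T` that cross `ab`. -/
def crossing (n : ℕ) (D U : Finset ℕ) (T : Finset (ℕ × ℕ)) (a b : ℕ) : Finset (ℕ × ℕ) :=
  T.filter (fun ε => Sep (pos n D U a) (pos n D U b) (pos n D U ε.1) (pos n D U ε.2))

theorem card_crossing_lt (h : Labels n D U) (hT : IsTriangulation n D U T) {a b : ℕ}
    {δ : ℕ × ℕ} (hδ : δ ∈ T)
    (hs : Sep (pos n D U a) (pos n D U b) (pos n D U δ.1) (pos n D U δ.2)) :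
    (crossing n D U T a δ.2).card < (crossing n D U T a b).card ∧
      (crossing n D U T δ.1 b).card < (crossing n D U T a b).card := by
  constructor <;> refine Finset.card_lt_card
        ((Finset.ssubset_iff_of_subset ?_).2 ⟨δ, ?_, ?_⟩)
  · intro ε hε
    simp only [crossing, Finset.mem_filter] at hε ⊢
    exact ⟨hε.1, hs.of_sep hε.2
      (h.not_sep hT (edge_of_mem hT hδ).2.2 (edge_of_mem hT hε.1).2.2)⟩
  · simp only [crossing, Finset.mem_filter]
    exact ⟨hδ, hs⟩
  · simp only [crossing, Finset.mem_filter, not_and]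
    intro _
    unfold Sep Cyc
    omega
  · intro ε hε
    simp only [crossing, Finset.mem_filter] at hε ⊢
    exact ⟨hε.1, (hs.swap_left.swap_right.of_sep hε.2.swap_left
      (h.not_sep hT (edge_of_mem hT hδ).2.2.symm (edge_of_mem hT hε.1).2.2)).swap_left⟩
  · simp only [crossing, Finset.mem_filter]
    exact ⟨hδ, hs⟩
  · simp only [crossing, Finset.mem_filter, not_and]
    intro _
    unfold Sep Cyc
    omega

theorem excess_nonneg (h : Labels n D U) (hT : IsTriangulation n D U T) {a b : ℕ}
    (hab : a < b) (hb : b ≤ n + 2) :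
    0 ≤ excess n D U T a b ∧ (¬ EdgeOf n D U T a b → 0 < excess n D U T a b) := by
  by_cases e : EdgeOf n D U T a b
  · exact ⟨(h.excess_eq_zero hT hab (e.edge hab hb)).ge, fun hn => absurd e hn⟩
  · obtain ⟨δ, hδ, hs⟩ := h.exists_mem_sep hT hab hb e
    obtain ⟨hδ1, hδ2, eδ⟩ := edge_of_mem hT hδ
    have hz := h.excess_eq_zero hT hδ1 eδ
    have hlt := h.card_crossing_lt hT hδ hs
    suffices key : a < δ.2 ∧ δ.1 < b ∧ excess n D U T a δ.2 + excess n D U T δ.1 b <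
        excess n D U T a b + excess n D U T δ.1 δ.2 by
      have i1 := (h.excess_nonneg hT key.1 hδ2).1
      have i2 := (h.excess_nonneg hT key.2.1 hb).1
      have := key.2.2
      exact ⟨by linarith, fun _ => by linarith⟩
    rcases hs with ⟨h1, h2⟩ | ⟨h1, h2⟩
    · have h3 := h.lt_of_cyc_cyc hab hb hδ1 hδ2 h1 h2
      exact ⟨h3.1, h3.2, h.excess_cross hab hb hδ1 hδ2 h1 h2⟩
    · have h1' : Cyc (pos n D U δ.1) (pos n D U a) (pos n D U δ.2) := by
        unfold Cyc at *; omega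
      have h2' : Cyc (pos n D U δ.2) (pos n D U b) (pos n D U δ.1) := by
        unfold Cyc at *; omega
      have h3 := h.lt_of_cyc_cyc hδ1 hδ2 hab hb h1' h2'
      refine ⟨h3.2, h3.1, ?_⟩
      have := h.excess_cross (T := T) hδ1 hδ2 hab hb h1' h2'
      linarith
termination_by (crossing n D U T a b).card
decreasing_by
  · exact hlt.1
  · exact hlt.2

theorem Bel_of_isBoundaryEdge (h : Labels n D U) {a b : ℕ} (hab : a < b) (hb : b ≤ n + 2)
    (e : IsBoundaryEdge n D U (a, b)) :
    Bel n D U (a, b) = ∅ ∨ Bel n D U (a, b) = Finset.Icc 1 (n + 1) := by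
  have e := (h.isBoundaryEdge_iff hab hb).1 e
  by_cases he : pos n D U a + 1 = pos n D U b ∨ (pos n D U b = 0 ∧ pos n D U a = n + 2)
  · refine Or.inl (h.Bel_eq_empty hab hb fun v hv => ?_)
    have := h.pos_le hv
    unfold Cyc
    omega
  · refine Or.inr (h.Bel_eq_Icc hab hb fun v hv => ?_)
    have := h.pos_le hv
    unfold Cyc
    omega

theorem exists_between_of_not_isBoundaryEdge (h : Labels n D U) {a b : ℕ} (hab : a < b)
    (hb : b ≤ n + 2) (e : ¬ IsBoundaryEdge n D U (a, b)) :
    (∃ v, v ≤ n + 2 ∧ Cyc (pos n D U a) (pos n D U v) (pos n D U b)) ∧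
    ∃ v, v ≤ n + 2 ∧ Cyc (pos n D U b) (pos n D U v) (pos n D U a) := by
  rw [h.isBoundaryEdge_iff hab hb] at e
  have hpa := h.pos_le (v := a) (by omega)
  have hpb := h.pos_le hb
  have hne : pos n D U a ≠ pos n D U b := fun hh =>
    absurd (h.pos_inj (by omega) hb hh) (by omega)
  have key : ∀ p q : ℕ, p ≤ n + 2 → q ≤ n + 2 → p + 1 ≠ q → ¬ (q = 0 ∧ p = n + 2) → p ≠ q →
      ∃ v, v ≤ n + 2 ∧ Cyc p (pos n D U v) q := by
    intro p q hp hq h1 h2 h3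
    obtain ⟨v, hv, hpv⟩ := h.exists_pos (p := if p = n + 2 then 0 else p + 1)
      (by split_ifs <;> omega)
    refine ⟨v, hv, ?_⟩
    rw [hpv]
    unfold Cyc
    split_ifs <;> omega
  exact ⟨key _ _ hpa hpb (by omega) (by omega) hne, key _ _ hpb hpa (by omega) (by omega) hne.symm⟩

theorem cross_symm (h : Labels n D U) {δ ε : ℕ × ℕ} (hδ : IsDiag n δ) (hε : IsDiag n ε)
    (hc : Cross n D U δ ε) : Cross n D U ε δ := by
  obtain ⟨a, b⟩ := δ
  obtain ⟨c, d⟩ := ε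
  obtain ⟨h1, h2⟩ := hδ
  obtain ⟨h3, h4⟩ := hε
  simp only at h1 h2 h3 h4
  rw [h.cross_iff (by omega) h2 (by omega) h4] at hc
  rw [h.cross_iff (by omega) h4 (by omega) h2]
  exact hc.symm

theorem not_cross_self (δ : ℕ × ℕ) : ¬ Cross n D U δ δ := fun hc => hc.2.2.1 rfl

/-- Every set of pairwise non-crossing internal diagonals extends to a triangulation. -/
theorem exists_triangulation_of_noncrossing (h : Labels n D U) {S : Finset (ℕ × ℕ)}
    (hS : ∀ δ ∈ S, IsInternalDiag n D U δ) (hS' : ∀ δ ∈ S, ∀ δ' ∈ S, ¬ Cross n D U δ δ') :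
    ∃ T, IsTriangulation n D U T ∧ S ⊆ T := by
  have hbox : ∀ A : Finset (ℕ × ℕ), (∀ δ ∈ A, IsInternalDiag n D U δ) →
      A ⊆ Finset.range (n + 3) ×ˢ Finset.range (n + 3) := by
    intro A hA δ hδ
    have h1 := (hA δ hδ).1.1
    have h2 := (hA δ hδ).1.2
    simp only [Finset.mem_product, Finset.mem_range]
    omega
  obtain ⟨T, hT, hmax⟩ := Finset.exists_max_image
    ((Finset.range (n + 3) ×ˢ Finset.range (n + 3)).powerset.filter
      fun A => S ⊆ A ∧ (∀ δ ∈ A, IsInternalDiag n D U δ) ∧ ∀ δ ∈ A, ∀ δ' ∈ A, ¬ Cross n D U δ δ')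
    Finset.card ⟨S, by
      rw [Finset.mem_filter, Finset.mem_powerset]
      exact ⟨hbox S hS, subset_rfl, hS, hS'⟩⟩
  rw [Finset.mem_filter] at hT
  obtain ⟨-, hST, hT1, hT2⟩ := hT
  refine ⟨T, ⟨hT1, hT2, fun δ hδ hδT => ?_⟩, hST⟩
  by_contra hno
  push Not at hno
  have hins : ∀ ε ∈ insert δ T, IsInternalDiag n D U ε := by
    intro ε hε
    rcases Finset.mem_insert.1 hε with rfl | hε
    exacts [hδ, hT1 ε hε]
  have := hmax (insert δ T) (by
    rw [Finset.mem_filter, Finset.mem_powerset]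
    refine ⟨hbox _ hins, hST.trans (Finset.subset_insert _ _), hins, ?_⟩
    intro ε hε ε' hε'
    rcases Finset.mem_insert.1 hε with rfl | m <;> rcases Finset.mem_insert.1 hε' with rfl | m'
    · exact not_cross_self _
    · exact hno ε' m'
    · exact fun hc => hno ε m (h.cross_symm (hT1 ε m).1 hδ.1 hc)
    · exact hT2 ε m ε' m')
  rw [Finset.card_insert_of_notMem hδT] at this
  omega

theorem exists_triangulation_mem (h : Labels n D U) {δ : ℕ × ℕ} (hδ : IsInternalDiag n D U δ) :
    ∃ T, IsTriangulation n D U T ∧ δ ∈ T := by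
  obtain ⟨T, hT, hS⟩ := h.exists_triangulation_of_noncrossing (S := {δ})
    (by simpa using hδ) (by simpa using not_cross_self δ)
  exact ⟨T, hT, hS (Finset.mem_singleton_self δ)⟩

theorem eq_of_subset {T' : Finset (ℕ × ℕ)} (hT : IsTriangulation n D U T)
    (hT' : IsTriangulation n D U T') (hs : T ⊆ T') : T = T' := by
  refine hs.antisymm fun δ hδ => ?_
  by_contra hn
  obtain ⟨δ', h1, h2⟩ := hT.2.2 δ (hT'.1 δ hδ) hn
  exact hT'.2.1 δ hδ δ' (hs h1) h2

theorem eq_pair_of_sep {p q r s t u : ℕ} (h1 : Cyc p r q) (h2 : Cyc q s p)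
    (hc : Sep r s t u) (n1 : ¬ Sep p r t u) (n2 : ¬ Sep r q t u) (n3 : ¬ Sep q s t u)
    (n4 : ¬ Sep s p t u) : (t = p ∧ u = q) ∨ (t = q ∧ u = p) := by
  have key : ∀ t u, Cyc r t s → Cyc s u r → ¬ Sep p r t u → ¬ Sep r q t u → ¬ Sep q s t u →
      ¬ Sep s p t u → t = q ∧ u = p := by
    intro t u ht hu n1 n2 n3 n4
    have hqt : t = q := by
      by_contra hne
      rcases ht.between hne with h3 | h3
      · exact n2 (Or.inl ⟨h3, by unfold Cyc at *; omega⟩)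
      · exact n3 (Or.inl ⟨h3, by unfold Cyc at *; omega⟩)
    refine ⟨hqt, ?_⟩
    by_contra hne
    rcases hu.between hne with h3 | h3
    · exact n4 (Or.inr ⟨h3, by unfold Cyc at *; omega⟩)
    · exact n1 (Or.inr ⟨h3, by unfold Cyc at *; omega⟩)
  rcases hc with ⟨h3, h4⟩ | ⟨h3, h4⟩
  · exact Or.inr (key t u h3 h4 n1 n2 n3 n4)
  · exact Or.inl (key u t h3 h4 (fun h => n1 h.swap_right) (fun h => n2 h.swap_right)
      (fun h => n3 h.swap_right) fun h => n4 h.swap_right).symm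

/-- Every diagonal of a triangulation can be exchanged while keeping all the others. -/
theorem exists_flip (h : Labels n D U) (hT : IsTriangulation n D U T) {δ : ℕ × ℕ} (hδ : δ ∈ T) :
    ∃ T', IsTriangulation n D U T' ∧ T.erase δ ⊆ T' ∧ δ ∉ T' := by
  obtain ⟨a, b⟩ := δ
  obtain ⟨hab, hb, e⟩ := edge_of_mem hT hδ
  simp only at hab hb e
  obtain ⟨⟨v, hv, hcv⟩, w, hw, hcw⟩ :=
    h.exists_between_of_not_isBoundaryEdge hab hb (hT.1 _ hδ).2
  obtain ⟨c, eac, ecb, hc⟩ := h.exists_apex hT e hv hcv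
  obtain ⟨d, ebd, eda, hd⟩ := h.exists_apex hT e.symm hw hcw
  have hsep : Sep (pos n D U a) (pos n D U b) (pos n D U c) (pos n D U d) := Or.inl ⟨hc, hd⟩
  have hcd : c ≠ d := by
    rintro rfl
    unfold Cyc at hc hd
    omega
  have main : ∀ c' d', c' < d' → d' ≤ n + 2 →
      Sep (pos n D U a) (pos n D U b) (pos n D U c') (pos n D U d') →
      (∀ t u, Sep (pos n D U c') (pos n D U d') t u → Sep (pos n D U c) (pos n D U d) t u) →
      ∃ T', IsTriangulation n D U T' ∧ T.erase (a, b) ⊆ T' ∧ (a, b) ∉ T' := by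
    intro c' d' hcd' hd' hs himp
    have hc'n : c' ≤ n + 2 := by omega
    have hint : IsInternalDiag n D U (c', d') := by
      refine ⟨⟨hcd', hd'⟩, fun hbd => ?_⟩
      exact h.not_sep hT e (EdgeOf.edge (Or.inr hbd) hcd' hd') hs
    have hnc : ∀ ε ∈ T.erase (a, b), ¬ Cross n D U (c', d') ε := by
      rintro ⟨f, g⟩ hε hcr
      obtain ⟨hne, hεT⟩ := Finset.mem_erase.1 hε
      obtain ⟨hfg, hg, efg⟩ := edge_of_mem hT hεT
      simp only at hfg hg efg
      have hf : f ≤ n + 2 := by omega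
      rw [h.cross_iff hc'n hd' hf hg] at hcr
      rcases eq_pair_of_sep hc hd (himp _ _ hcr) (h.not_sep hT eac efg) (h.not_sep hT ecb efg)
        (h.not_sep hT ebd efg) (h.not_sep hT eda efg) with ⟨h1, h2⟩ | ⟨h1, h2⟩
      · exact hne (by rw [h.pos_inj hf (by omega) h1, h.pos_inj hg hb h2])
      · have h3 := h.pos_inj hf hb h1
        have h4 := h.pos_inj hg (by omega) h2
        omega
    obtain ⟨T', hT', hsub⟩ := h.exists_triangulation_of_noncrossing
      (S := insert (c', d') (T.erase (a, b)))
      (by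
        intro ε hε
        rcases Finset.mem_insert.1 hε with rfl | hε
        exacts [hint, hT.1 ε (Finset.mem_of_mem_erase hε)])
      (by
        intro ε hε ε' hε'
        rcases Finset.mem_insert.1 hε with rfl | hε <;>
          rcases Finset.mem_insert.1 hε' with rfl | hε'
        · exact not_cross_self _
        · exact hnc ε' hε'
        · exact fun hx =>
            hnc ε hε (h.cross_symm (hT.1 ε (Finset.mem_of_mem_erase hε)).1 hint.1 hx)
        · exact hT.2.1 ε (Finset.mem_of_mem_erase hε) ε' (Finset.mem_of_mem_erase hε'))
    refine ⟨T', hT', (Finset.subset_insert _ _).trans hsub, fun hmem => ?_⟩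
    exact hT'.2.1 _ hmem _ (hsub (Finset.mem_insert_self _ _))
      ((h.cross_iff (by omega) hb hc'n hd').2 hs)
  rcases lt_or_gt_of_ne hcd with h1 | h1
  · exact main c d h1 eda.1 hsep fun _ _ hx => hx
  · exact main d c h1 ecb.1 hsep.swap_right fun _ _ hx => hx.swap_left

theorem edgeOf_iff_mem {a b : ℕ} (hδ : IsInternalDiag n D U (a, b)) :
    EdgeOf n D U T a b ↔ (a, b) ∈ T :=
  ⟨fun e => e.resolve_right hδ.2, Or.inl⟩

theorem tri_le_sum_Bel (h : Labels n D U) (hT : IsTriangulation n D U T) {δ : ℕ × ℕ}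
    (hδ : IsInternalDiag n D U δ) :
    tri (bel n D U δ) ≤ ∑ j ∈ Bel n D U δ, xcoord n D U T j := by
  have := (h.excess_nonneg hT hδ.1.1 hδ.1.2).1
  unfold excess at this
  linarith

theorem sum_Bel_eq_tri_iff (h : Labels n D U) (hT : IsTriangulation n D U T) {δ : ℕ × ℕ}
    (hδ : IsInternalDiag n D U δ) :
    ∑ j ∈ Bel n D U δ, xcoord n D U T j = tri (bel n D U δ) ↔ δ ∈ T := by
  constructor
  · intro heq
    by_contra hn
    have := (h.excess_nonneg hT hδ.1.1 hδ.1.2).2 ((edgeOf_iff_mem hδ).not.2 hn)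
    unfold excess at this
    linarith
  · intro hmem
    have := h.excess_eq_zero hT hδ.1.1 (edge_of_mem hT hmem).2.2
    unfold excess at this
    linarith

theorem eq_of_xcoord_eq (h : Labels n D U) {T' : Finset (ℕ × ℕ)} (hT : IsTriangulation n D U T)
    (hT' : IsTriangulation n D U T') (heq : xcoord n D U T = xcoord n D U T') : T = T' := by
  refine eq_of_subset hT hT' fun δ hδ => ?_
  rw [← h.sum_Bel_eq_tri_iff hT' (hT.1 δ hδ), ← heq]
  exact (h.sum_Bel_eq_tri_iff hT (hT.1 δ hδ)).2 hδ

end Labels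

/-- The polytope spanned by the points `x(T)`. -/
def polytope (n : ℕ) (D U : Finset ℕ) : Set (ℕ → ℝ) :=
  convexHull ℝ {x : ℕ → ℝ | ∃ T : Finset (ℕ × ℕ), IsTriangulation n D U T ∧ x = xcoord n D U T}

/-- The intersection of the polytope with the hyperplane of the diagonal `δ`. -/
def face (n : ℕ) (D U : Finset ℕ) (δ : ℕ × ℕ) : Set (ℕ → ℝ) :=
  polytope n D U ∩ {x : ℕ → ℝ | ∑ j ∈ Bel n D U δ, x j = tri (bel n D U δ)}

/-- The linear form `x ↦ ∑ j ∈ A, x j`. -/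
def sumForm (A : Finset ℕ) : (ℕ → ℝ) →ₗ[ℝ] ℝ := ∑ j ∈ A, LinearMap.proj j

@[simp]
theorem sumForm_apply (A : Finset ℕ) (v : ℕ → ℝ) : sumForm A v = ∑ j ∈ A, v j := by
  simp [sumForm]

/-- Vectors supported on `[n+1]` with coordinate sum zero. -/
def direction (n : ℕ) : Submodule ℝ (ℕ → ℝ) where
  carrier := {v | (∀ j, j ∉ Finset.Icc 1 (n + 1) → v j = 0) ∧ sumForm (Finset.Icc 1 (n + 1)) v = 0}
  zero_mem' := ⟨fun _ _ => rfl, map_zero _⟩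
  add_mem' := fun {v w} hv hw => ⟨fun j hj => by simp [hv.1 j hj, hw.1 j hj], by
    rw [map_add, hv.2, hw.2, add_zero]⟩
  smul_mem' := fun c {v} hv => ⟨fun j hj => by simp [hv.1 j hj], by
    rw [map_smul, hv.2, smul_zero]⟩

theorem finrank_direction : Module.finrank ℝ (direction n) = n := by
  let f : (Finset.Icc 1 (n + 1) → ℝ) →ₗ[ℝ] ℝ := ∑ j, LinearMap.proj j
  have hf : f ≠ 0 := by
    intro h0
    have := LinearMap.congr_fun h0 (Pi.single ⟨1, by simp⟩ 1)
    simp [f] at this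
  have h1 := Module.Dual.finrank_ker_add_one_of_ne_zero (f := f) hf
  rw [Module.finrank_fintype_fun_eq_card, Fintype.card_coe, Nat.card_Icc] at h1
  have e : direction n ≃ₗ[ℝ] LinearMap.ker f := {
    toFun := fun v => ⟨fun j => v.1 j, by
      have := v.2.2
      rw [sumForm_apply, ← Finset.sum_coe_sort] at this
      simpa [f] using this⟩
    invFun := fun v => ⟨fun j => if hj : j ∈ Finset.Icc 1 (n + 1) then v.1 ⟨j, hj⟩ else 0,
      fun j hj => dif_neg hj, by
        have := v.2
        rw [sumForm_apply, ← Finset.sum_coe_sort]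
        simpa [f] using this⟩
    left_inv := fun v => by
      ext j
      by_cases hj : j ∈ Finset.Icc 1 (n + 1)
      · simp only [dif_pos hj]
      · simp only [dif_neg hj, v.2.1 j hj]
    right_inv := fun v => by
      ext j
      simp only [dif_pos j.2]
    map_add' := fun _ _ => rfl
    map_smul' := fun _ _ => rfl }
  rw [e.finrank_eq]
  omega

/-- A module with an injective map to `ι → ℝ` that hits a nonzero multiple of each coordinate
vector has dimension `|ι|`. -/
theorem finrank_eq_card_of_single {ι M : Type*} [Fintype ι] [DecidableEq ι] [AddCommGroup M]
    [Module ℝ M] (L : M →ₗ[ℝ] ι → ℝ) (hL : Function.Injective L)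
    (hs : ∀ i, ∃ v, L v i ≠ 0 ∧ ∀ k, k ≠ i → L v k = 0) :
    Module.finrank ℝ M = Fintype.card ι := by
  have hsurj : Function.Surjective L := by
    intro y
    choose v hv hv' using hs
    refine ⟨∑ i, (y i / L (v i) i) • v i, ?_⟩
    ext k
    rw [map_sum, Finset.sum_apply, Finset.sum_eq_single k]
    · rw [map_smul, Pi.smul_apply, smul_eq_mul, div_mul_cancel₀ _ (hv k)]
    · intro i _ hik
      rw [map_smul, Pi.smul_apply, hv' i k hik.symm, smul_zero]
    · exact fun hk => absurd (Finset.mem_univ k) hk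
  rw [(LinearEquiv.ofBijective L ⟨hL, hsurj⟩).finrank_eq, Module.finrank_fintype_fun_eq_card]

namespace Labels

/-- A vector of `direction n` is determined by its values on the diagonals of a triangulation. -/
theorem eq_zero_of_sumForm (h : Labels n D U) (hT : IsTriangulation n D U T) {v : ℕ → ℝ}
    (hv : v ∈ direction n) (hφ : ∀ δ ∈ T, sumForm (Bel n D U δ) v = 0) : v = 0 := by
  have h0 := hv.2
  simp only [sumForm_apply] at hφ h0
  have hedge : ∀ {a b}, a < b → b ≤ n + 2 → EdgeOf n D U T a b →
      ∑ j ∈ Bel n D U (a, b), v j = 0 := by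
    rintro a b hab hb (e | e)
    · exact hφ _ e
    · rcases h.Bel_of_isBoundaryEdge hab hb e with h1 | h1 <;> rw [h1]
      · simp
      · exact h0
  ext j
  by_cases hj : j ∈ Finset.Icc 1 (n + 1)
  · obtain ⟨hj1, hj2⟩ := Finset.mem_Icc.1 hj
    obtain ⟨i, k, hij, hjk, hk, e1, e2, e3⟩ := h.exists_triangle hT hj1 hj2
    have z1 := hedge hij (by omega) e1
    have z2 := hedge hjk hk e2
    have z3 := hedge (hij.trans hjk) hk e3
    by_cases hjU : j ∈ U
    · have := h.sum_Bel_upper hij hjk hk hjU v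
      simp only [z1, z2, z3, h0] at this
      simpa using this.symm
    · have := h.sum_Bel_lower hij hjk hk hjU v
      simp only [z1, z2, z3] at this
      simpa using this.symm
  · exact hv.1 j hj

theorem xcoord_mem_polytope (hT : IsTriangulation n D U T) : xcoord n D U T ∈ polytope n D U :=
  subset_convexHull ℝ _ ⟨T, hT, rfl⟩

theorem eq_zero_of_mem_polytope {x : ℕ → ℝ} (hx : x ∈ polytope n D U) {j : ℕ}
    (hj : j ∉ Finset.Icc 1 (n + 1)) : x j = 0 := by
  refine convexHull_min (t := {x : ℕ → ℝ | x j = 0}) ?_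
    (convex_hyperplane (LinearMap.proj (R := ℝ) (φ := fun _ : ℕ => ℝ) j).isLinear 0) hx
  rintro _ ⟨T, -, rfl⟩
  exact xcoord_eq_zero hj

theorem sum_eq_of_mem_polytope (h : Labels n D U) {x : ℕ → ℝ} (hx : x ∈ polytope n D U) :
    sumForm (Finset.Icc 1 (n + 1)) x = tri (n + 1) := by
  refine convexHull_min (t := {x : ℕ → ℝ | sumForm (Finset.Icc 1 (n + 1)) x = tri (n + 1)}) ?_
    (convex_hyperplane (sumForm _).isLinear _) hx
  rintro _ ⟨T, hT, rfl⟩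
  have := h.totalExcess_eq_zero hT
  unfold totalExcess at this
  rw [Set.mem_ofPred_eq, sumForm_apply]
  linarith

theorem tri_le_of_mem_polytope (h : Labels n D U) {δ : ℕ × ℕ} (hδ : IsInternalDiag n D U δ)
    {x : ℕ → ℝ} (hx : x ∈ polytope n D U) :
    tri (bel n D U δ) ≤ sumForm (Bel n D U δ) x := by
  refine convexHull_min (t := {x : ℕ → ℝ | tri (bel n D U δ) ≤ sumForm (Bel n D U δ) x}) ?_
    (convex_halfSpace_ge (sumForm _).isLinear _) hx
  rintro _ ⟨T, hT, rfl⟩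
  rw [Set.mem_ofPred_eq, sumForm_apply]
  exact h.tri_le_sum_Bel hT hδ

theorem sub_mem_direction_of_mem_polytope (h : Labels n D U) {x y : ℕ → ℝ}
    (hx : x ∈ polytope n D U) (hy : y ∈ polytope n D U) : x - y ∈ direction n :=
  ⟨fun j hj => by simp [eq_zero_of_mem_polytope hx hj, eq_zero_of_mem_polytope hy hj], by
    rw [map_sub, h.sum_eq_of_mem_polytope hx, h.sum_eq_of_mem_polytope hy, sub_self]⟩

theorem isExtreme_face (h : Labels n D U) {δ : ℕ × ℕ} (hδ : IsInternalDiag n D U δ) :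
    IsExtreme ℝ (polytope n D U) (face n D U δ) := by
  refine ⟨Set.inter_subset_left, ?_⟩
  rintro x hx y hy z ⟨-, hz⟩ ⟨a, b, ha, hb, hab, rfl⟩
  refine ⟨hx, ?_⟩
  have h1 := h.tri_le_of_mem_polytope hδ hx
  have h2 := h.tri_le_of_mem_polytope hδ hy
  simp only [Set.mem_ofPred_eq, ← sumForm_apply, map_add, map_smul, smul_eq_mul] at hz ⊢
  refine le_antisymm ?_ h1
  have h3 := mul_le_mul_of_nonneg_left h2 hb.le
  refine le_of_mul_le_mul_left ?_ ha
  linear_combination hz + h3 - tri (bel n D U δ) * hab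

theorem xcoord_mem_face (h : Labels n D U) (hT : IsTriangulation n D U T) {δ : ℕ × ℕ}
    (hδ : δ ∈ T) : xcoord n D U T ∈ face n D U δ :=
  ⟨xcoord_mem_polytope hT, (h.sum_Bel_eq_tri_iff hT (hT.1 δ hδ)).2 hδ⟩

theorem xcoord_mem_extremePoints (h : Labels n D U) (hT : IsTriangulation n D U T) :
    xcoord n D U T ∈ Set.extremePoints ℝ (polytope n D U) := by
  refine ⟨xcoord_mem_polytope hT, fun x hx y hy hxy => ?_⟩
  refine sub_eq_zero.1 (h.eq_zero_of_sumForm hT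
    (h.sub_mem_direction_of_mem_polytope hx (xcoord_mem_polytope hT)) fun δ hδ => ?_)
  have h1 := h.xcoord_mem_face hT hδ
  have h2 := (h.isExtreme_face (hT.1 δ hδ)).2 hx hy h1 hxy
  rw [map_sub, sumForm_apply, sumForm_apply, h1.2, h2.2, sub_self]

/-- Exchanging the diagonal `δ` moves `x(T)` within the hyperplanes of the other diagonals. -/
theorem exists_flip_direction (h : Labels n D U) (hT : IsTriangulation n D U T) {δ : ℕ × ℕ}
    (hδ : δ ∈ T) : ∃ T', IsTriangulation n D U T' ∧ T.erase δ ⊆ T' ∧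
      sumForm (Bel n D U δ) (xcoord n D U T' - xcoord n D U T) ≠ 0 ∧
      ∀ ε ∈ T, ε ≠ δ → sumForm (Bel n D U ε) (xcoord n D U T' - xcoord n D U T) = 0 := by
  obtain ⟨T', hT', hsub, hn⟩ := h.exists_flip hT hδ
  refine ⟨T', hT', hsub, ?_, fun ε hε hne => ?_⟩
  · rw [map_sub, sumForm_apply, sumForm_apply,
      (h.sum_Bel_eq_tri_iff hT (hT.1 δ hδ)).2 hδ, sub_ne_zero]
    exact (h.sum_Bel_eq_tri_iff hT' (hT.1 δ hδ)).not.2 hn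
  · rw [map_sub, sumForm_apply, sumForm_apply, (h.sum_Bel_eq_tri_iff hT (hT.1 ε hε)).2 hε,
      (h.sum_Bel_eq_tri_iff hT' (hT.1 ε hε)).2 (hsub (Finset.mem_erase.2 ⟨hne, hε⟩)), sub_self]

/-- The linear forms of a finite set of diagonals, restricted to a subspace. -/
def forms (n : ℕ) (D U : Finset ℕ) (S : Finset (ℕ × ℕ)) (M : Submodule ℝ (ℕ → ℝ)) :
    M →ₗ[ℝ] S → ℝ :=
  (LinearMap.pi fun δ : S => sumForm (Bel n D U δ)).comp M.subtype

/-- A triangulation has `n` diagonals. -/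
theorem card_eq (h : Labels n D U) (hT : IsTriangulation n D U T) : T.card = n := by
  rw [← Fintype.card_coe, ← finrank_eq_card_of_single (forms n D U T (direction n)),
    finrank_direction]
  · rw [injective_iff_map_eq_zero]
    intro v hv
    exact Subtype.ext (h.eq_zero_of_sumForm hT v.2 fun δ hδ => congrFun hv ⟨δ, hδ⟩)
  · rintro ⟨δ, hδ⟩
    obtain ⟨T', hT', -, h1, h2⟩ := h.exists_flip_direction hT hδ
    exact ⟨⟨_, h.sub_mem_direction_of_mem_polytope (xcoord_mem_polytope hT')
      (xcoord_mem_polytope hT)⟩, h1, fun k hk => h2 k k.2 fun hh => hk (Subtype.ext hh)⟩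

theorem finrank_vectorSpan_face (h : Labels n D U) {δ : ℕ × ℕ} (hδ : IsInternalDiag n D U δ) :
    Module.finrank ℝ (vectorSpan ℝ (face n D U δ)) = n - 1 := by
  obtain ⟨T, hT, hδT⟩ := h.exists_triangulation_mem hδ
  have hle : vectorSpan ℝ (face n D U δ) ≤
      direction n ⊓ LinearMap.ker (sumForm (Bel n D U δ)) := by
    rw [vectorSpan_def, Submodule.span_le]
    rintro _ ⟨x, hx, y, hy, rfl⟩
    refine ⟨h.sub_mem_direction_of_mem_polytope hx.1 hy.1, ?_⟩
    change sumForm (Bel n D U δ) (x - y) = 0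
    rw [map_sub, sumForm_apply, sumForm_apply, hx.2, hy.2, sub_self]
  rw [finrank_eq_card_of_single (forms n D U (T.erase δ) (vectorSpan ℝ (face n D U δ))),
    Fintype.card_coe, Finset.card_erase_of_mem hδT, h.card_eq hT]
  · rw [injective_iff_map_eq_zero]
    intro v hv
    refine Subtype.ext (h.eq_zero_of_sumForm hT (hle v.2).1 fun ε hε => ?_)
    rcases eq_or_ne ε δ with rfl | hne
    · exact (hle v.2).2
    · exact congrFun hv ⟨ε, Finset.mem_erase.2 ⟨hne, hε⟩⟩
  · rintro ⟨ε, hε⟩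
    obtain ⟨hne, hεT⟩ := Finset.mem_erase.1 hε
    obtain ⟨T', hT', hsub, h1, h2⟩ := h.exists_flip_direction hT hεT
    have hδT' : δ ∈ T' := hsub (Finset.mem_erase.2 ⟨hne.symm, hδT⟩)
    exact ⟨⟨_, vsub_mem_vectorSpan ℝ (h.xcoord_mem_face hT' hδT') (h.xcoord_mem_face hT hδT)⟩, h1,
      fun k hk => h2 k (Finset.mem_of_mem_erase k.2) fun hh => hk (Subtype.ext hh)⟩

end Labels

end Spines

namespace Spines

/-- The map `T ↦ x(T)` is injective on triangulations of `P`; each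
point `x(T)` is an extreme point of the polytope `conv{x(T')}`; and for every internal
diagonal `δ`, the intersection of the polytope with the hyperplane
`∑_{j∈Bel(δ)} x j = (bel(δ)+1)·bel(δ)/2` is a face (an extreme subset) of
dimension `n−1`, i.e. a facet. -/
theorem xcoord_injective_vertices_facets (n : ℕ) (hn : 1 ≤ n) (D U : Finset ℕ)
    (hUD : D ∪ U = Finset.Icc 1 (n + 1)) (hdisj : Disjoint D U) :
    (∀ T T' : Finset (ℕ × ℕ), IsTriangulation n D U T → IsTriangulation n D U T' →
      xcoord n D U T = xcoord n D U T' → T = T') ∧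
    (∀ T : Finset (ℕ × ℕ), IsTriangulation n D U T →
      xcoord n D U T ∈ Set.extremePoints ℝ
        (convexHull ℝ {x : ℕ → ℝ | ∃ T'' : Finset (ℕ × ℕ),
          IsTriangulation n D U T'' ∧ x = xcoord n D U T''})) ∧
    (∀ δ : ℕ × ℕ, IsInternalDiag n D U δ →
      IsExtreme ℝ
        (convexHull ℝ {x : ℕ → ℝ | ∃ T : Finset (ℕ × ℕ),
          IsTriangulation n D U T ∧ x = xcoord n D U T})
        (convexHull ℝ {x : ℕ → ℝ | ∃ T : Finset (ℕ × ℕ),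
            IsTriangulation n D U T ∧ x = xcoord n D U T} ∩
          {x : ℕ → ℝ | ∑ j ∈ Bel n D U δ, x j
              = ((bel n D U δ : ℝ) + 1) * (bel n D U δ : ℝ) / 2}) ∧
      Module.finrank ℝ
        (vectorSpan ℝ
          (convexHull ℝ {x : ℕ → ℝ | ∃ T : Finset (ℕ × ℕ),
              IsTriangulation n D U T ∧ x = xcoord n D U T} ∩
            {x : ℕ → ℝ | ∑ j ∈ Bel n D U δ, x j
                = ((bel n D U δ : ℝ) + 1) * (bel n D U δ : ℝ) / 2})) = n - 1) := by
  have h : Labels n D U := ⟨hUD, hdisj⟩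
  exact ⟨fun T T' hT hT' heq => h.eq_of_xcoord_eq hT hT' heq,
    fun T hT => h.xcoord_mem_extremePoints hT,
    fun δ hδ => ⟨h.isExtreme_face hδ, h.finrank_vectorSpan_face hδ⟩⟩

end Spines
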